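/- arXiv:1512.08494 — 2 statements merged into one kernel-verified Lean document; each statement's English description precedes it below -/
import Mathlib

section
/- Let n, k ∈ ℕ with 3 ≤ k ≤ n−1 and let {D_I}, indexed by the k-subsets I of [n], be an l-treelike family of real numbers. Then there exists exactly one internal-nonzero-weighted essential pseudostar of kind (n,k) with leaf set [n] that realizes the family {D_I}. -/
/-- A weighted finite tree with leaf set labelled by `Fin n`:
a finite vertex type `V`, a tree `G` on `V`, an injective labelling `leaf` of the
degree-one vertices by `Fin n` (every vertex of degree one is a labelled leaf),
and a weight function `w` on edges (zero off the edge set). -/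
structure WTree (n : ℕ) where
  V : Type
  fintypeV : Fintype V
  G : SimpleGraph V
  isTree : G.IsTree
  leaf : Fin n → V
  leafInj : Function.Injective leaf
  leafSpec : ∀ v : V, (G.neighborSet v).ncard = 1 ↔ v ∈ Set.range leaf
  w : Sym2 V → ℝ
  wSupport : ∀ e, e ∉ G.edgeSet → w e = 0

namespace WTree

variable {n : ℕ}

/-- The degree of a vertex. -/
noncomputable def deg (T : WTree n) (v : T.V) : ℕ := (T.G.neighborSet v).ncard

/-- A node is a vertex of degree `> 2`. -/
def IsNode (T : WTree n) (v : T.V) : Prop := 2 < T.deg v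

/-- A tree is essential if it has no vertices of degree `2`. -/
def Essential (T : WTree n) : Prop := ∀ v : T.V, T.deg v ≠ 2

/-- The set of edges lying on the path between two vertices. -/
def pathEdges (T : WTree n) (u v : T.V) : Set (Sym2 T.V) :=
  {e | ∃ p : T.G.Walk u v, p.IsPath ∧ e ∈ p.edges}

/-- The edge set of the minimal subtree containing the leaves in `S`. -/
def subtreeEdges (T : WTree n) (S : Set (Fin n)) : Set (Sym2 T.V) :=
  {e | ∃ i ∈ S, ∃ j ∈ S, e ∈ T.pathEdges (T.leaf i) (T.leaf j)}

/-- `D_I(T)`: the weight of the minimal subtree of `T` containing the leaves in `I`. -/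
noncomputable def D (T : WTree n) (I : Finset (Fin n)) : ℝ :=
  ∑ᶠ e ∈ T.subtreeEdges ↑I, T.w e

/-- The total weight of the tree. -/
noncomputable def Dtot (T : WTree n) : ℝ := ∑ᶠ e ∈ T.G.edgeSet, T.w e

/-- An edge is a twig edge if it lies on the path from some leaf to the nearest node. -/
def IsTwigEdge (T : WTree n) (e : Sym2 T.V) : Prop :=
  ∃ (i : Fin n) (v : T.V), T.IsNode v ∧
    ∃ p : T.G.Walk (T.leaf i) v, p.IsPath ∧
      (∀ u ∈ p.support, T.IsNode u → u = v) ∧ e ∈ p.edges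

/-- Internal-nonzero-weighted: every internal (non-twig) edge has nonzero weight. -/
def InternalNonzero (T : WTree n) : Prop :=
  ∀ e ∈ T.G.edgeSet, ¬ T.IsTwigEdge e → T.w e ≠ 0

/-- Positive-weighted: all edge weights are positive. -/
def PositiveWeighted (T : WTree n) : Prop := ∀ e ∈ T.G.edgeSet, 0 < T.w e

/-- The leaves lying on the side of vertex `a` after removing the edge `e`. -/
def sideLeaves (T : WTree n) (e : Sym2 T.V) (a : T.V) : Set (Fin n) :=
  {i | e ∉ T.pathEdges (T.leaf i) a}

/-- A pseudostar of kind `(n, k)`: every edge divides the leaf set into two parts,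
at least one of which has cardinality `≥ k`. -/
def IsPseudostar (T : WTree n) (k : ℕ) : Prop :=
  ∀ a b : T.V, T.G.Adj a b →
    k ≤ (T.sideLeaves s(a, b) a).ncard ∨ k ≤ (T.sideLeaves s(a, b) b).ncard

/-- `T` realizes the family `D₀` of `k`-weights. -/
def Realizes (T : WTree n) (k : ℕ) (D₀ : Finset (Fin n) → ℝ) : Prop :=
  ∀ I : Finset (Fin n), I.card = k → T.D I = D₀ I

/-- Two leaves are neighbours if the path between them contains exactly one node. -/
def Neighbours (T : WTree n) (i j : Fin n) : Prop :=
  i ≠ j ∧ ∃ p : T.G.Walk (T.leaf i) (T.leaf j), p.IsPath ∧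
    ∃! v : T.V, v ∈ p.support ∧ T.IsNode v

/-- The Buneman index `⟨i,j | l,m⟩` holds iff the paths `i–j` and `l–m` are disjoint,
equivalently in `T|_{i,j,l,m}` the leaves `i,j` are neighbours, `l,m` are neighbours
and `i,l` are not neighbours. -/
def Buneman (T : WTree n) (i j l m : Fin n) : Prop :=
  ∀ (p : T.G.Walk (T.leaf i) (T.leaf j)) (q : T.G.Walk (T.leaf l) (T.leaf m)),
    p.IsPath → q.IsPath → ∀ v : T.V, v ∈ p.support → v ∉ q.support

/-- The minimal subtree spanned by the four leaves `i,j,l,m` is a star (i.e. all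
pairwise paths share a common vertex). -/
def StarQuartet (T : WTree n) (i j l m : Fin n) : Prop :=
  ∃ c : T.V, ∀ x ∈ ({i, j, l, m} : Set (Fin n)), ∀ y ∈ ({i, j, l, m} : Set (Fin n)),
    x ≠ y → ∀ p : T.G.Walk (T.leaf x) (T.leaf y), p.IsPath → c ∈ p.support

/-- A cherry: a set of leaves pairwise neighbours. -/
def IsCherry (T : WTree n) (C : Set (Fin n)) : Prop :=
  ∀ i ∈ C, ∀ j ∈ C, i ≠ j → T.Neighbours i j

/-- A complete cherry: a cherry not strictly contained in another cherry. -/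
def IsCompleteCherry (T : WTree n) (C : Set (Fin n)) : Prop :=
  T.IsCherry C ∧ ¬ ∃ C' : Set (Fin n), T.IsCherry C' ∧ C ⊂ C'

/-- A star is a tree with only one node. -/
def IsStar (T : WTree n) : Prop := ∃! v : T.V, T.IsNode v

/-- `x` is the median of the three leaves `a,b,c`: it lies on all three pairwise paths. -/
def IsMedian (T : WTree n) (a b c : Fin n) (x : T.V) : Prop :=
  (∀ p : T.G.Walk (T.leaf a) (T.leaf b), p.IsPath → x ∈ p.support) ∧
  (∀ p : T.G.Walk (T.leaf a) (T.leaf c), p.IsPath → x ∈ p.support) ∧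
  (∀ p : T.G.Walk (T.leaf b) (T.leaf c), p.IsPath → x ∈ p.support)

/-- The weight of the twig associated to the leaf `i` (the path from the leaf to the
nearest node). -/
noncomputable def twigWeight (T : WTree n) (i : Fin n) : ℝ :=
  ∑ᶠ e ∈ {e : Sym2 T.V | ∃ v : T.V, T.IsNode v ∧
      ∃ p : T.G.Walk (T.leaf i) v, p.IsPath ∧
        (∀ u ∈ p.support, T.IsNode u → u = v) ∧ e ∈ p.edges}, T.w e

/-- Two weighted trees with leaf set `Fin n` are equal (isomorphic respecting the
leaf labels and the weights). -/
def Isom (T T' : WTree n) : Prop :=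
  ∃ φ : T.V ≃ T'.V,
    (∀ a b : T.V, T.G.Adj a b ↔ T'.G.Adj (φ a) (φ b)) ∧
    (∀ i : Fin n, φ (T.leaf i) = T'.leaf i) ∧
    (∀ a b : T.V, T.w s(a, b) = T'.w s(φ a, φ b))

/-- `T'` is obtained from `T` by the `k`-IO operation on the edge `{a, b}`:
the edge divides the leaf set into two parts each of cardinality `< k`; it is
contracted (via the quotient map `φ`) and `w{a,b}/k` is added to the weight of
every twig (i.e. to every pendant edge). -/
def IOStepOn (k : ℕ) (T T' : WTree n) (a b : T.V) : Prop :=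
  T.G.Adj a b ∧
  (T.sideLeaves s(a, b) a).ncard < k ∧ (T.sideLeaves s(a, b) b).ncard < k ∧
  ∃ φ : T.V → T'.V,
    Function.Surjective φ ∧ φ a = φ b ∧
    (∀ x y : T.V, φ x = φ y → x = y ∨ s(x, y) = s(a, b)) ∧
    (∀ i : Fin n, φ (T.leaf i) = T'.leaf i) ∧
    (∀ u v : T'.V, T'.G.Adj u v ↔
      ∃ x y : T.V, φ x = u ∧ φ y = v ∧ T.G.Adj x y ∧ s(x, y) ≠ s(a, b)) ∧
    (∀ x y : T.V, T.G.Adj x y → s(x, y) ≠ s(a, b) →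
      ((∃ i : Fin n, T.leaf i = x ∨ T.leaf i = y) →
        T'.w s(φ x, φ y) = T.w s(x, y) + T.w s(a, b) / k) ∧
      (¬ (∃ i : Fin n, T.leaf i = x ∨ T.leaf i = y) →
        T'.w s(φ x, φ y) = T.w s(x, y)))

/-- `T'` is obtained from `T` by a `k`-IO operation. -/
def IOStep (k : ℕ) (T T' : WTree n) : Prop := ∃ a b : T.V, IOStepOn k T T' a b

/-- `T'` is obtained from `T` by a `k`-OI operation (the inverse of a `k`-IO operation). -/
def OIStep (k : ℕ) (T T' : WTree n) : Prop := IOStep k T' T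

/-- `T'` is obtained from `T` by inserting an internal edge of weight `0`
(the inverse of contracting it). -/
def InsertZeroStep (T T' : WTree n) : Prop :=
  ∃ a b : T'.V, T'.G.Adj a b ∧ ¬ T'.IsTwigEdge s(a, b) ∧ T'.w s(a, b) = 0 ∧
    ∃ φ : T'.V → T.V,
      Function.Surjective φ ∧ φ a = φ b ∧
      (∀ x y : T'.V, φ x = φ y → x = y ∨ s(x, y) = s(a, b)) ∧
      (∀ i : Fin n, φ (T'.leaf i) = T.leaf i) ∧
      (∀ u v : T.V, T.G.Adj u v ↔
        ∃ x y : T'.V, φ x = u ∧ φ y = v ∧ T'.G.Adj x y ∧ s(x, y) ≠ s(a, b)) ∧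
      (∀ x y : T'.V, T'.G.Adj x y → s(x, y) ≠ s(a, b) → T.w s(φ x, φ y) = T'.w s(x, y))

/-- Replace the weight function of `T`. -/
def reweight (T : WTree n) (w' : Sym2 T.V → ℝ)
    (h : ∀ e, e ∉ T.G.edgeSet → w' e = 0) : WTree n :=
  { T with w := w', wSupport := h }

end WTree

section Splits

variable {α : Type*}

/-- The bipartition `S ∣ Sᶜ` splits `I` into two nonempty parts. -/
def Finset.Splits (S I : Finset α) : Prop := (∃ x ∈ I, x ∈ S) ∧ ∃ x ∈ I, x ∉ S

/-- The bipartitions given by `S` and `T` are compatible: one of the four intersections of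
their sides is empty. -/
def Finset.SplitCompat (S T : Finset α) : Prop :=
  (∀ x ∈ S, x ∉ T) ∨ (∀ x ∈ S, x ∈ T) ∨ (∀ x ∈ T, x ∈ S) ∨ ∀ x, x ∈ S ∨ x ∈ T

/-- A family of pairwise compatible bipartitions, each represented by both of its sides. -/
structure IsSplitSystem [Fintype α] [DecidableEq α] (F : Set (Finset α)) : Prop where
  compl_mem : ∀ S ∈ F, Sᶜ ∈ F
  compat : ∀ S ∈ F, ∀ T ∈ F, S.SplitCompat T

variable [Fintype α] [DecidableEq α]

open Classical in
/-- The `I`-weight of a weight function on subsets. -/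
noncomputable def splitSum (d : Finset α → ℝ) (I : Finset α) : ℝ :=
  ∑ S, if S.Splits I then d S else 0

/-- `S` has at least two elements on each side. -/
def Nontriv (S : Finset α) : Prop := 2 ≤ S.card ∧ 2 ≤ Sᶜ.card

theorem splitSum_four_point {k : ℕ} (h3 : 3 ≤ k) {d : Finset α → ℝ}
    (hd : ∀ I : Finset α, I.card = k → splitSum d I = 0)
    {i j l m : α} (hij : i ≠ j) (hil : i ≠ l) (hjm : j ≠ m) (hlm : l ≠ m)
    {X : Finset α} (hX : X.card + 2 = k) (hiX : i ∉ X) (hjX : j ∉ X) (hlX : l ∉ X) (hmX : m ∉ X) :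
    ∑ S : Finset α, (if X ⊆ S ∨ X ⊆ Sᶜ then
      (if i ∈ S then d S else 0) * ((if j ∈ S then 1 else 0) - (if l ∈ S then 1 else 0)) -
      (if m ∈ S then d S else 0) * ((if j ∈ S then 1 else 0) - (if l ∈ S then 1 else 0))
      else 0) = 0 := by
  classical
  have key : ∀ a b : α, a ≠ b → a ∉ X → b ∉ X → splitSum d (insert a (insert b X)) = 0 := by
    intro a b hab ha hb
    apply hd
    rw [Finset.card_insert_of_notMem (by simp [hab, ha]), Finset.card_insert_of_notMem hb]
    omega
  have h1 := key i j hij hiX hjX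
  have h2 := key l m hlm hlX hmX
  have h3' := key i l hil hiX hlX
  have h4 := key j m hjm hjX hmX
  have hs : splitSum d (insert i (insert l X)) + splitSum d (insert j (insert m X)) -
    splitSum d (insert i (insert j X)) - splitSum d (insert l (insert m X)) = 0 := by
    rw [h1, h2, h3', h4]; ring
  refine Eq.trans ?_ hs
  unfold splitSum
  rw [← Finset.sum_add_distrib, ← Finset.sum_sub_distrib, ← Finset.sum_sub_distrib]
  refine Finset.sum_congr rfl fun S _ => ?_
  obtain ⟨x, hx⟩ : X.Nonempty := by
    rw [← Finset.card_pos]; omega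
  by_cases hXS : X ⊆ S
  · have : ∀ a b, S.Splits (insert a (insert b X)) ↔ ¬ (a ∈ S ∧ b ∈ S) := by
      intro a b
      unfold Finset.Splits
      have := hXS hx
      have hX' : ∀ y ∈ X, y ∈ S := fun y hy => hXS hy
      simp only [Finset.mem_insert]
      grind
    simp only [this, hXS, true_or, if_true]
    by_cases i ∈ S <;> by_cases j ∈ S <;> by_cases l ∈ S <;> by_cases m ∈ S <;> simp [*]
  by_cases hXS' : X ⊆ Sᶜ
  · have : ∀ a b, S.Splits (insert a (insert b X)) ↔ (a ∈ S ∨ b ∈ S) := by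
      intro a b
      unfold Finset.Splits
      have := hXS' hx
      have hX' : ∀ y ∈ X, y ∉ S := fun y hy => by simpa using hXS' hy
      simp only [Finset.mem_insert]
      grind
    simp only [this, hXS', or_true, if_true]
    by_cases i ∈ S <;> by_cases j ∈ S <;> by_cases l ∈ S <;> by_cases m ∈ S <;> simp [*]
  · have : ∀ a b, S.Splits (insert a (insert b X)) := by
      intro a b
      obtain ⟨y, hy, hy'⟩ := Finset.not_subset.1 hXS
      obtain ⟨z, hz, hz'⟩ := Finset.not_subset.1 hXS'
      exact ⟨⟨z, by simp [hz], by simpa using hz'⟩, ⟨y, by simp [hy], hy'⟩⟩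
    simp [this, hXS, hXS']

theorem nontriv_of_mem {S : Finset α} {i j l m : α} (hij : i ≠ j) (hlm : l ≠ m)
    (hi : i ∈ S) (hj : j ∈ S) (hl : l ∉ S) (hm : m ∉ S) : Nontriv S := by
  constructor
  · rw [← Finset.card_pair hij]
    exact Finset.card_le_card (by simp [Finset.insert_subset_iff, hi, hj])
  · rw [← Finset.card_pair hlm]
    exact Finset.card_le_card (by simp [Finset.insert_subset_iff, hl, hm])

theorem Nontriv.compl {S : Finset α} (h : Nontriv S) : Nontriv Sᶜ :=
  ⟨h.2, by rw [compl_compl]; exact h.1⟩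

/-- If `S` is the only side with nonzero weight containing `i` but not `m` and separating
`j` from `l`, and all `k`-weights vanish, then its weight vanishes. -/
theorem eq_zero_of_unique_side {k : ℕ} (h3 : 3 ≤ k) {d : Finset α → ℝ}
    (hsymm : ∀ S, d Sᶜ = d S)
    (hd : ∀ I : Finset α, I.card = k → splitSum d I = 0)
    {S : Finset α} (hS : k ≤ Sᶜ.card) {i j l m : α} (hij : i ≠ j) (hlm : l ≠ m)
    (hi : i ∈ S) (hj : j ∈ S) (hl : l ∉ S) (hm : m ∉ S)
    (hu : ∀ H, d H ≠ 0 → Nontriv H → i ∈ H → m ∉ H →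
      (j ∈ H ∧ l ∉ H ∨ j ∉ H ∧ l ∈ H) → H = S) : d S = 0 := by
  classical
  obtain ⟨X, hXs, hXc⟩ : ∃ X ⊆ Sᶜ \ {l, m}, X.card = k - 2 := by
    apply Finset.exists_subset_card_eq
    have h1 : ({l, m} : Finset α) ⊆ Sᶜ := by simp [Finset.insert_subset_iff, hl, hm]
    rw [Finset.card_sdiff_of_subset h1, Finset.card_pair hlm]
    omega
  have hX : ∀ x ∈ X, x ∉ S ∧ x ≠ l ∧ x ≠ m := fun x hx => by
    have := hXs hx
    simpa using this
  have hil : i ≠ l := fun h => hl (h ▸ hi)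
  have hjm : j ≠ m := fun h => hm (h ▸ hj)
  have hsum := splitSum_four_point h3 hd (X := X) hij hil hjm hlm (by omega)
    (fun h => (hX _ h).1 hi) (fun h => (hX _ h).1 hj) (fun h => (hX _ h).2.1 rfl)
    (fun h => (hX _ h).2.2 rfl)
  have hne : S ≠ Sᶜ := fun h => by
    have : i ∈ Sᶜ := h ▸ hi
    simp [hi] at this
  rw [← Finset.sum_subset (Finset.subset_univ {S, Sᶜ}), Finset.sum_pair hne] at hsum
  · have hX1 : X ⊆ Sᶜ := fun x hx => by simpa using (hX x hx).1
    simp [hi, hj, hl, hm, hX1, hsymm] at hsum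
    linarith
  · intro H _ hH
    simp only [Finset.mem_insert, Finset.mem_singleton, not_or] at hH
    by_cases hdH : d H = 0
    · simp [hdH]
    have h1 := hu H hdH
    have h2 := hu Hᶜ (by rwa [hsymm])
    have h3 : Hᶜ ≠ S := fun h => hH.2 (by rw [← h, compl_compl])
    have hN : ∀ a b c e, a ≠ b → c ≠ e → a ∈ H → b ∈ H → c ∉ H → e ∉ H → Nontriv H :=
      fun a b c e hab hce ha hb hc he => nontriv_of_mem hab hce ha hb hc he
    simp only [Finset.mem_compl, not_not] at h2
    have g1 : Nontriv H → i ∈ H → m ∉ H → (j ∈ H ∧ l ∉ H ∨ j ∉ H ∧ l ∈ H) → False :=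
      fun a b c e => hH.1 (h1 a b c e)
    have g2 : Nontriv H → i ∉ H → m ∈ H → (j ∉ H ∧ l ∈ H ∨ j ∈ H ∧ l ∉ H) → False :=
      fun a b c e => h3 (h2 a.compl b c e)
    clear h1 h2 hu hsum hX hsymm hd
    by_cases hi' : i ∈ H <;> by_cases hj' : j ∈ H <;> by_cases hl' : l ∈ H <;>
      by_cases hm' : m ∈ H <;> simp only [hi', hj', hl', hm', if_true, if_false, sub_self,
        mul_zero, zero_mul, ite_self]
    · exact (g1 (hN i j l m hij hlm hi' hj' hl' hm') hi' hm' (Or.inl ⟨hj', hl'⟩)).elim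
    · exact (g1 (hN i l j m hil hjm hi' hl' hj' hm') hi' hm' (Or.inr ⟨hj', hl'⟩)).elim
    · exact (g2 (hN j m i l hjm hil hj' hm' hi' hl') hi' hm' (Or.inr ⟨hj', hl'⟩)).elim
    · exact (g2 (hN l m i j hlm hij hl' hm' hi' hj') hi' hm' (Or.inl ⟨hj', hl'⟩)).elim

/-- In a split system, for every point `m` there is a point `l` of `A` other than `m`
such that no proper subset of `A` in the system contains both. -/
theorem IsSplitSystem.exists_separated {F : Set (Finset α)} (hF : IsSplitSystem F)
    {A : Finset α} {i : α} (m : α) (hi : i ∉ A) (hA : 2 ≤ A.card) :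
    ∃ l ∈ A, l ≠ m ∧ ∀ H ∈ F, m ∈ H → l ∈ H → H ⊆ A → H = A := by
  classical
  by_cases hex : ∃ H ∈ F, m ∈ H ∧ H ⊂ A
  · obtain ⟨M, hM⟩ := Finset.exists_maximal
      (s := Finset.univ.filter fun H => H ∈ F ∧ m ∈ H ∧ H ⊂ A)
      (by obtain ⟨H, h1, h2, h3⟩ := hex; exact ⟨H, by simp [h1, h2, h3]⟩)
    have hM1 := hM.prop
    simp only [Finset.mem_filter, Finset.mem_univ, true_and] at hM1
    obtain ⟨hMF, hmM, hMA⟩ := hM1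
    obtain ⟨l, hlA, hlM⟩ := Finset.exists_of_ssubset hMA
    refine ⟨l, hlA, fun h => hlM (h ▸ hmM), fun H hH hmH hlH hHA => ?_⟩
    by_contra hne
    have hHs : H ⊂ A := lt_of_le_of_ne hHA hne
    rcases hF.compat H hH M hMF with h | h | h | h
    · exact h m hmH hmM
    · exact hlM (h l hlH)
    · exact hlM (hM.le_of_ge (y := H) (by simp [hH, hmH, hHs]) h hlH)
    · exact hi ((h i).elim (fun h => hHA h) fun h => hMA.1 h)
  · obtain ⟨l, hl, hlm⟩ := Finset.exists_mem_ne (by omega : 1 < A.card) m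
    refine ⟨l, hl, hlm, fun H hH hmH _ hHA => ?_⟩
    by_contra hne
    exact hex ⟨H, hH, hmH, lt_of_le_of_ne hHA hne⟩

/-- Two split systems admit a common separated pair inside any set with at least two elements. -/
theorem IsSplitSystem.exists_separated_pair {F F' : Set (Finset α)} (hF : IsSplitSystem F)
    (hF' : IsSplitSystem F') {A : Finset α} {i : α} (hi : i ∉ A) (hA : 2 ≤ A.card) :
    ∃ l ∈ A, ∃ m ∈ A, l ≠ m ∧ ∀ H, H ∈ F ∨ H ∈ F' → m ∈ H → l ∈ H → H ⊆ A → H = A := by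
  obtain ⟨m, hm⟩ : A.Nonempty := by rw [← Finset.card_pos]; omega
  obtain ⟨l, hl, hlm, hl'⟩ := hF.exists_separated m hi hA
  obtain ⟨x, hx, hxm, hx'⟩ := hF'.exists_separated m hi hA
  have trans : ∀ {E : Set (Finset α)}, IsSplitSystem E → ∀ {a b c : α},
      (∃ H ∈ E, a ∈ H ∧ b ∈ H ∧ H ⊂ A) → (∃ H ∈ E, b ∈ H ∧ c ∈ H ∧ H ⊂ A) →
      ∃ H ∈ E, a ∈ H ∧ c ∈ H ∧ H ⊂ A := by
    rintro E hE a b c ⟨H, hH, ha, hb, hHA⟩ ⟨K, hK, hb', hc, hKA⟩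
    rcases hE.compat H hH K hK with h | h | h | h
    · exact (h b hb hb').elim
    · exact ⟨K, hK, h a ha, hc, hKA⟩
    · exact ⟨H, hH, ha, h c hc, hHA⟩
    · exact (hi ((h i).elim (fun h => hHA.1 h) fun h => hKA.1 h)).elim
  have conv : ∀ {E : Set (Finset α)} {a b : α}, ¬ (∃ H ∈ E, a ∈ H ∧ b ∈ H ∧ H ⊂ A) →
      ∀ H ∈ E, b ∈ H → a ∈ H → H ⊆ A → H = A := fun h H hH hb ha hs => by
    by_contra hne
    exact h ⟨H, hH, ha, hb, lt_of_le_of_ne hs hne⟩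
  by_cases h1 : ∃ H ∈ F', l ∈ H ∧ m ∈ H ∧ H ⊂ A
  · by_cases h2 : ∃ H ∈ F, m ∈ H ∧ x ∈ H ∧ H ⊂ A
    · have h3 : ¬ ∃ H ∈ F, l ∈ H ∧ x ∈ H ∧ H ⊂ A := fun ⟨H, hH, ha, hb, hs⟩ => by
        obtain ⟨K, hK, a, b, c⟩ := trans hF ⟨H, hH, ha, hb, hs⟩
          (by obtain ⟨K, a, b, c, e⟩ := h2; exact ⟨K, a, c, b, e⟩)
        exact c.ne (hl' K hK b a c.1)
      have h4 : ¬ ∃ H ∈ F', l ∈ H ∧ x ∈ H ∧ H ⊂ A := fun ⟨H, hH, ha, hb, hs⟩ => by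
        obtain ⟨K, hK, a, b, c⟩ := trans hF' ⟨H, hH, hb, ha, hs⟩ h1
        exact c.ne (hx' K hK b a c.1)
      refine ⟨l, hl, x, hx, ?_, fun H hH => hH.elim (conv h3 H) (conv h4 H)⟩
      rintro rfl
      obtain ⟨K, a, b, c, e⟩ := h2
      exact e.ne (hl' K a b c e.1)
    · refine ⟨m, hm, x, hx, hxm.symm, fun H hH => hH.elim (conv h2 H) fun hH a b =>
        hx' H hH b a⟩
  · exact ⟨l, hl, m, hm, hlm, fun H hH => hH.elim (hl' H) (conv h1 H)⟩

/-- A nontrivial side `B` of minimal size with nonzero weight cannot belong to the support of a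
difference of two split systems with the same `k`-weights. -/
theorem no_minimal_side {k : ℕ} (h3 : 3 ≤ k) {d : Finset α → ℝ}
    (hsymm : ∀ S, d Sᶜ = d S)
    (hd : ∀ I : Finset α, I.card = k → splitSum d I = 0)
    {F F' : Set (Finset α)} (hF : IsSplitSystem F) (hF' : IsSplitSystem F')
    (hsupp : ∀ S, Nontriv S → (d S ≠ 0 ↔ S ∈ F ∨ S ∈ F'))
    (hbig : ∀ S, d S ≠ 0 → k ≤ S.card ∨ k ≤ Sᶜ.card)
    {B : Finset α} (hB : Nontriv B) (hBk : k ≤ Bᶜ.card) (hBF : B ∈ F)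
    (hmin : ∀ S, Nontriv S → d S ≠ 0 → k ≤ Sᶜ.card → B.card ≤ S.card) : False := by
  classical
  have hBd : d B ≠ 0 := (hsupp B hB).2 (Or.inl hBF)
  have hsub : ∀ S, Nontriv S → d S ≠ 0 → S ⊆ B → S = B := fun S hS hSd hSB =>
    Finset.eq_of_subset_of_card_le hSB (hmin S hS hSd
      (hBk.trans (Finset.card_le_card (Finset.compl_subset_compl.2 hSB))))
  -- no member of `F` separates two points of `B`
  have hnF : ∀ S ∈ F, Nontriv S → ∀ i ∈ B, ∀ m ∈ B, i ∈ S → m ∉ S → False := by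
    intro S hS hSn i hi m hm hiS hmS
    have hSd : d S ≠ 0 := (hsupp S hSn).2 (Or.inl hS)
    rcases hF.compat S hS B hBF with h | h | h | h
    · exact h i hiS hi
    · have := hsub S hSn hSd h
      exact hmS (this ▸ hm)
    · exact hmS (h m hm)
    · have := hsub Sᶜ hSn.compl (by rwa [hsymm]) fun x hx =>
        (h x).resolve_left (by simpa using hx)
      rw [← this] at hi
      simp [hiS] at hi
  -- no nontrivial side of nonzero weight does
  have hnF' : ∀ S, Nontriv S → d S ≠ 0 → ∀ i ∈ B, ∀ m ∈ B, i ∈ S → m ∉ S → False := by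
    by_contra! hcon
    obtain ⟨S₀, hS₀⟩ : ∃ S, Nontriv S ∧ d S ≠ 0 ∧ k ≤ Sᶜ.card ∧
        ∃ i ∈ B, ∃ m ∈ B, i ∈ S ∧ m ∉ S := by
      obtain ⟨S, hSn, hSd, i, hi, m, hm, hiS, hmS, -⟩ := hcon
      rcases hbig S hSd with h | h
      · exact ⟨Sᶜ, hSn.compl, by rwa [hsymm], by rwa [compl_compl], m, hm, i, hi, by simpa,
          by simpa⟩
      · exact ⟨S, hSn, hSd, h, i, hi, m, hm, hiS, hmS⟩
    obtain ⟨S, hSm⟩ := Finset.exists_minimal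
      (s := Finset.univ.filter fun S => Nontriv S ∧ d S ≠ 0 ∧ k ≤ Sᶜ.card ∧
        ∃ i ∈ B, ∃ m ∈ B, i ∈ S ∧ m ∉ S) ⟨S₀, by simpa using hS₀⟩
    have hSp := hSm.prop
    simp only [Finset.mem_filter, Finset.mem_univ, true_and] at hSp
    obtain ⟨hSn, hSd, hSk, i, hi, m, hm, hiS, hmS⟩ := hSp
    have memF' : ∀ H, Nontriv H → d H ≠ 0 → i ∈ H → m ∉ H → H ∈ F' := fun H hHn hHd h1 h2 =>
      ((hsupp H hHn).1 hHd).resolve_left fun h => hnF H h hHn i hi m hm h1 h2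
    have hSF := memF' S hSn hSd hiS hmS
    obtain ⟨j, hjS, hji⟩ := Finset.exists_mem_ne (by have := hSn.1; omega : 1 < S.card) i
    obtain ⟨l, hlS, hlm, hl⟩ := hF'.exists_separated (A := Sᶜ) (i := i) m
      (by simpa) hSn.2
    have hlS' : l ∉ S := by simpa using hlS
    refine hSd (eq_zero_of_unique_side h3 hsymm hd hSk hji.symm hlm hiS hjS hlS' hmS ?_)
    intro H hHd hHn hiH hmH hcase
    have hHF := memF' H hHn hHd hiH hmH
    rcases hcase with ⟨hjH, hlH⟩ | ⟨hjH, hlH⟩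
    · rcases hF'.compat H hHF S hSF with h | h | h | h
      · exact (h i hiH hiS).elim
      · have hle : H ≤ S := h
        exact le_antisymm hle (hSm.2 (y := H) (by
          simp only [Finset.mem_filter, Finset.mem_univ, true_and]
          exact ⟨hHn, hHd, hSk.trans (Finset.card_le_card (Finset.compl_subset_compl.2 hle)),
            i, hi, m, hm, hiH, hmH⟩) hle)
      · have := hl Hᶜ (hF'.compl_mem H hHF) (by simpa) (by simpa)
          (Finset.compl_subset_compl.2 h)
        exact compl_injective this
      · exact ((h m).elim hmH hmS).elim
    · rcases hF'.compat H hHF S hSF with h | h | h | h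
      · exact (h i hiH hiS).elim
      · exact (hlS' (h l hlH)).elim
      · exact (hjH (h j hjS)).elim
      · exact ((h m).elim hmH hmS).elim
  obtain ⟨i, hi, j, hj, hij⟩ := Finset.one_lt_card.1 (by have := hB.1; omega : 1 < B.card)
  obtain ⟨l, hl, m, hm, hlm, hsep⟩ := hF.exists_separated_pair hF' (A := Bᶜ) (i := i)
    (by simpa) hB.2
  simp only [Finset.mem_compl] at hl hm
  refine hBd (eq_zero_of_unique_side h3 hsymm hd hBk hij hlm hi hj hl hm ?_)
  intro H hHd hHn hiH hmH hcase
  have hBH : ∀ x ∈ B, x ∈ H := fun x hx => by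
    by_contra hxH
    exact hnF' H hHn hHd i hi x hx hiH hxH
  have hlH : l ∉ H := by
    rcases hcase with h | h
    · exact h.2
    · exact (h.1 (hBH j hj)).elim
  have hHF := (hsupp Hᶜ hHn.compl).1 (by rwa [hsymm])
  exact compl_injective (hsep Hᶜ hHF (by simpa) (by simpa) (Finset.compl_subset_compl.2 hBH))

theorem IsSplitSystem.support {F : Set (Finset α)} (hF : IsSplitSystem F) {d : Finset α → ℝ}
    (hsymm : ∀ S, d Sᶜ = d S) : IsSplitSystem {S | S ∈ F ∧ d S ≠ 0} where
  compl_mem S hS := ⟨hF.compl_mem S hS.1, by rw [hsymm]; exact hS.2⟩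
  compat S hS T hT := hF.compat S hS.1 T hT.1

theorem splitSum_eq_sum_singleton {d : Finset α → ℝ} (hsymm : ∀ S, d Sᶜ = d S)
    (htriv : ∀ S, d S ≠ 0 → S.card = 1 ∨ Sᶜ.card = 1) (hα : 3 ≤ Fintype.card α)
    {I : Finset α} (hI : 2 ≤ I.card) : splitSum d I = 2 * ∑ x ∈ I, d {x} := by
  classical
  have h1 : ∀ S : Finset α, (if S.Splits I then d S else 0) =
      ∑ x ∈ I, ((if S = {x} then d {x} else 0) + if S = {x}ᶜ then d {x} else 0) := by
    intro S
    have hcc : ∀ x y : α, ({x} : Finset α)ᶜ ≠ {y} := fun x y h => by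
      have := congrArg Finset.card h
      rw [Finset.card_compl] at this
      simp at this
      omega
    have hsp : ∀ y, Finset.Splits {y} I ↔ y ∈ I := by
      intro y
      constructor
      · rintro ⟨⟨x, hx, hxy⟩, -⟩
        exact Finset.mem_singleton.1 hxy ▸ hx
      · intro hy
        obtain ⟨z, hz, hzy⟩ := Finset.exists_mem_ne (by omega : 1 < I.card) y
        exact ⟨⟨y, hy, by simp⟩, ⟨z, hz, by simpa using hzy⟩⟩
    have hsc : ∀ S : Finset α, Sᶜ.Splits I ↔ S.Splits I := by
      intro S
      simp [Finset.Splits, and_comm]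
    by_cases hS : d S = 0
    · rw [hS, ite_self]
      refine (Finset.sum_eq_zero fun x _ => ?_).symm
      have : ∀ T : Finset α, d T = 0 → (if T = {x} then d {x} else 0) = 0 := fun T hT => by
        split_ifs with h
        · rw [← h, hT]
        · rfl
      rw [this S hS, zero_add]
      split_ifs with h
      · rw [← hsymm, ← h, hS]
      · rfl
    rcases htriv S hS with h | h
    · obtain ⟨y, rfl⟩ := Finset.card_eq_one.1 h
      have : ∀ x, ({y} : Finset α) ≠ {x}ᶜ := fun x h => hcc x y h.symm
      simp only [this, if_false, add_zero, Finset.singleton_inj, hsp]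
      rw [Finset.sum_ite_eq]
    · obtain ⟨y, hy⟩ := Finset.card_eq_one.1 h
      obtain rfl : S = {y}ᶜ := by rw [← hy, compl_compl]
      simp only [hcc, if_false, zero_add, hsc, hsp, hsymm, compl_inj_iff, Finset.singleton_inj]
      rw [Finset.sum_ite_eq]
  unfold splitSum
  rw [Finset.sum_congr rfl fun S _ => h1 S, Finset.sum_comm, Finset.mul_sum]
  refine Finset.sum_congr rfl fun x _ => ?_
  rw [Finset.sum_add_distrib, Finset.sum_ite_eq', Finset.sum_ite_eq']
  simp [two_mul]

/-- The `k`-weights determine a weight function supported on a split system, provided that each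
of its splits has a side with at least `k` elements. -/
theorem eq_zero_of_splitSum_eq_zero {k : ℕ} (h3 : 3 ≤ k) (hk : k + 1 ≤ Fintype.card α)
    {d : Finset α → ℝ} (hsymm : ∀ S, d Sᶜ = d S) (h0 : d ∅ = 0)
    (hd : ∀ I : Finset α, I.card = k → splitSum d I = 0)
    {F F' : Set (Finset α)} (hF : IsSplitSystem F) (hF' : IsSplitSystem F')
    (hsupp : ∀ S, d S ≠ 0 → S ∈ F ∨ S ∈ F')
    (hbig : ∀ S, d S ≠ 0 → k ≤ S.card ∨ k ≤ Sᶜ.card) : d = 0 := by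
  classical
  have hnon : ∀ S, Nontriv S → d S = 0 := by
    by_contra! hcon
    obtain ⟨S₀, hS₀⟩ : ∃ S, Nontriv S ∧ d S ≠ 0 ∧ k ≤ Sᶜ.card := by
      obtain ⟨S, hSn, hSd⟩ := hcon
      rcases hbig S hSd with h | h
      · exact ⟨Sᶜ, hSn.compl, by rwa [hsymm], by rwa [compl_compl]⟩
      · exact ⟨S, hSn, hSd, h⟩
    obtain ⟨B, hB, hmin⟩ := Finset.exists_min_image
      (Finset.univ.filter fun S => Nontriv S ∧ d S ≠ 0 ∧ k ≤ Sᶜ.card) Finset.card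
      ⟨S₀, by simpa using hS₀⟩
    simp only [Finset.mem_filter, Finset.mem_univ, true_and] at hB hmin
    have hmin' := fun S h1 h2 h3 => hmin S ⟨h1, h2, h3⟩
    have hG := hF.support hsymm
    have hG' := hF'.support hsymm
    have hs : ∀ S, d S ≠ 0 ↔ S ∈ {S | S ∈ F ∧ d S ≠ 0} ∨ S ∈ {S | S ∈ F' ∧ d S ≠ 0} := by
      intro S
      have := hsupp S
      simp only [Set.mem_ofPred_eq]
      tauto
    rcases (hs B).1 hB.2.1 with h | h
    · exact no_minimal_side h3 hsymm hd hG hG' (fun S _ => hs S) hbig hB.1 hB.2.2 h hmin'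
    · exact no_minimal_side h3 hsymm hd hG' hG (fun S _ => (hs S).trans or_comm) hbig hB.1
        hB.2.2 h hmin'
  have htriv : ∀ S, d S ≠ 0 → S.card = 1 ∨ Sᶜ.card = 1 := by
    intro S hS
    have h1 : S.card ≠ 0 := fun h => hS (by rw [Finset.card_eq_zero.1 h, h0])
    have h2 : Sᶜ.card ≠ 0 := fun h => hS (by rw [← hsymm, Finset.card_eq_zero.1 h, h0])
    have h3 : ¬ (2 ≤ S.card ∧ 2 ≤ Sᶜ.card) := fun h => hS (hnon S h)
    omega
  have hsum : ∀ I : Finset α, I.card = k → ∑ x ∈ I, d {x} = 0 := by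
    intro I hI
    have := splitSum_eq_sum_singleton hsymm htriv (by omega) (I := I) (by omega)
    rw [hd I hI] at this
    linarith
  have heq : ∀ i j, d {i} = d {j} := by
    intro i j
    obtain ⟨J, hJ, hJc⟩ : ∃ J ⊆ ({i, j} : Finset α)ᶜ, J.card = k - 1 := by
      apply Finset.exists_subset_card_eq
      rw [Finset.card_compl]
      have := Finset.card_le_two (a := i) (b := j)
      omega
    have hi : i ∉ J := fun h => by simpa using hJ h
    have hj : j ∉ J := fun h => by simpa using hJ h
    have h1 := hsum (insert i J) (by rw [Finset.card_insert_of_notMem hi]; omega)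
    have h2 := hsum (insert j J) (by rw [Finset.card_insert_of_notMem hj]; omega)
    rw [Finset.sum_insert hi] at h1
    rw [Finset.sum_insert hj] at h2
    linarith
  have hsing : ∀ i, d {i} = 0 := by
    intro i
    obtain ⟨I, -, hI⟩ := Finset.exists_subset_card_eq
      (show k ≤ (Finset.univ : Finset α).card by rw [Finset.card_univ]; omega)
    have h1 := hsum I hI
    rw [Finset.sum_congr rfl fun x _ => heq x i, Finset.sum_const, hI, nsmul_eq_mul] at h1
    rcases mul_eq_zero.1 h1 with h | h
    · have : k = 0 := by exact_mod_cast h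
      omega
    · exact h
  funext S
  by_contra hS
  rcases htriv S hS with h | h
  · obtain ⟨x, rfl⟩ := Finset.card_eq_one.1 h
    exact hS (hsing x)
  · obtain ⟨x, hx⟩ := Finset.card_eq_one.1 h
    exact hS (by rw [← hsymm, hx]; exact hsing x)

end Splits

/-- A rooted presentation of a tree: each vertex other than the root `r` has a parent `p`, of
smaller height, and the edges join the vertices to their parents. -/
structure Rooting {V : Type*} (G : SimpleGraph V) (r : V) where
  p : V → V
  h : V → ℕ
  adj_iff : ∀ x y, G.Adj x y ↔ (x ≠ r ∧ p x = y) ∨ (y ≠ r ∧ p y = x)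
  h_lt : ∀ x, x ≠ r → h (p x) < h x

namespace Rooting

variable {V : Type*} {G : SimpleGraph V} {r : V} (R : Rooting G r)

/-- `x` is a descendant of `y`. -/
def le (x y : V) : Prop := Relation.ReflTransGen (fun a b => a ≠ r ∧ R.p a = b) x y

theorem le_refl (x : V) : R.le x x := Relation.ReflTransGen.refl

theorem le_iff {x y : V} : R.le x y ↔ x = y ∨ x ≠ r ∧ R.le (R.p x) y := by
  unfold le
  rw [Relation.ReflTransGen.cases_head_iff]
  simp

theorem le_trans {x y z : V} (h1 : R.le x y) (h2 : R.le y z) : R.le x z :=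
  Relation.ReflTransGen.trans h1 h2

theorem le_parent {x : V} (hx : x ≠ r) : R.le x (R.p x) :=
  R.le_iff.2 (Or.inr ⟨hx, R.le_refl _⟩)

theorem eq_or_h_lt {x y : V} (h : R.le x y) : x = y ∨ R.h y < R.h x := by
  induction h with
  | refl => exact Or.inl rfl
  | tail _ h2 ih =>
    obtain ⟨h3, rfl⟩ := h2
    have := R.h_lt _ h3
    rcases ih with rfl | h
    · exact Or.inr this
    · exact Or.inr (this.trans h)

theorem le_antisymm {x y : V} (h1 : R.le x y) (h2 : R.le y x) : x = y := by
  rcases R.eq_or_h_lt h1 with h | h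
  · exact h
  · rcases R.eq_or_h_lt h2 with h' | h'
    · exact h'.symm
    · omega

theorem le_root (x : V) : R.le x r := by
  induction hn : R.h x using Nat.strong_induction_on generalizing x with
  | _ n ih =>
    by_cases hx : x = r
    · rw [hx]
      exact R.le_refl _
    · exact R.le_iff.2 (Or.inr ⟨hx, ih _ (hn ▸ R.h_lt x hx) _ rfl⟩)

theorem root_le {y : V} (h : R.le r y) : y = r := R.le_antisymm (R.le_root y) h

theorem le_total {x y z : V} (h1 : R.le x y) (h2 : R.le x z) : R.le y z ∨ R.le z y :=
  Relation.ReflTransGen.total_of_right_unique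
    (fun _ _ _ h h' => h.2.symm.trans h'.2) h1 h2

theorem not_parent_le {y : V} (hy : y ≠ r) : ¬ R.le (R.p y) y := fun h => by
  have := R.h_lt y hy
  rcases R.eq_or_h_lt h with h | h
  · rw [h] at this; omega
  · omega

theorem adj_parent {y : V} (hy : y ≠ r) : G.Adj y (R.p y) :=
  (R.adj_iff _ _).2 (Or.inl ⟨hy, rfl⟩)

theorem edge_inj {x y : V} (hx : x ≠ r) (hy : y ≠ r) (h : s(x, R.p x) = s(y, R.p y)) :
    x = y := by
  rcases Sym2.eq_iff.1 h with h | ⟨h1, h2⟩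
  · exact h.1
  · have a := R.h_lt x hx
    have b := R.h_lt y hy
    rw [h2] at a
    rw [← h1] at b
    omega

theorem exists_edge {e : Sym2 V} (he : e ∈ G.edgeSet) : ∃ y, y ≠ r ∧ e = s(y, R.p y) := by
  induction e with
  | _ a b =>
    rcases (R.adj_iff a b).1 he with ⟨h, rfl⟩ | ⟨h, rfl⟩
    · exact ⟨a, h, rfl⟩
    · exact ⟨b, h, Sym2.eq_swap⟩

theorem edge_mem {y : V} (hy : y ≠ r) : s(y, R.p y) ∈ G.edgeSet := R.adj_parent hy

theorem le_iff_le_of_adj {a b y : V} (hab : G.Adj a b) (hne : s(a, b) ≠ s(y, R.p y)) :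
    R.le a y ↔ R.le b y := by
  have key : ∀ x, x ≠ r → s(x, R.p x) ≠ s(y, R.p y) → (R.le x y ↔ R.le (R.p x) y) := by
    intro x hx hxy
    rw [R.le_iff]
    have : x ≠ y := fun h => hxy (h ▸ rfl)
    simp [this, hx]
  rcases (R.adj_iff a b).1 hab with ⟨h, rfl⟩ | ⟨h, rfl⟩
  · exact key a h hne
  · exact (key b h (by rwa [Sym2.eq_swap])).symm

theorem le_iff_le_of_walk {u v y : V} (q : G.Walk u v) (hq : s(y, R.p y) ∉ q.edges) :
    R.le u y ↔ R.le v y := by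
  induction q with
  | nil => rfl
  | cons h q ih =>
    simp only [SimpleGraph.Walk.edges_cons, List.mem_cons, not_or] at hq
    exact (R.le_iff_le_of_adj h (Ne.symm hq.1)).trans (ih hq.2)

theorem exists_walk_of_le {u y : V} (hy : y ≠ r) (h : R.le u y) :
    ∃ q : G.Walk u y, s(y, R.p y) ∉ q.edges := by
  induction hn : R.h u using Nat.strong_induction_on generalizing u with
  | _ n ih =>
    by_cases huy : u = y
    · subst huy
      exact ⟨.nil, by simp⟩
    · obtain ⟨hu, h'⟩ := (R.le_iff.1 h).resolve_left huy
      obtain ⟨q, hq⟩ := ih _ (hn ▸ R.h_lt u hu) h' rfl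
      refine ⟨.cons (R.adj_parent hu) q, ?_⟩
      simp only [SimpleGraph.Walk.edges_cons, List.mem_cons, not_or]
      exact ⟨fun h => huy (R.edge_inj hy hu h).symm, hq⟩

theorem exists_walk_of_not_le {u y : V} (hy : y ≠ r) (h : ¬ R.le u y) :
    ∃ q : G.Walk u r, s(y, R.p y) ∉ q.edges := by
  induction hn : R.h u using Nat.strong_induction_on generalizing u with
  | _ n ih =>
    by_cases hu : u = r
    · subst hu
      exact ⟨.nil, by simp⟩
    · rw [R.le_iff] at h
      push Not at h
      obtain ⟨q, hq⟩ := ih _ (hn ▸ R.h_lt u hu) (h.2 hu) rfl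
      refine ⟨.cons (R.adj_parent hu) q, ?_⟩
      simp only [SimpleGraph.Walk.edges_cons, List.mem_cons, not_or]
      exact ⟨fun h' => h.1 (R.edge_inj hy hu h').symm, hq⟩

theorem exists_walk {u v y : V} (hy : y ≠ r) (h : R.le u y ↔ R.le v y) :
    ∃ q : G.Walk u v, s(y, R.p y) ∉ q.edges := by
  by_cases hu : R.le u y
  · obtain ⟨q, hq⟩ := R.exists_walk_of_le hy hu
    obtain ⟨q', hq'⟩ := R.exists_walk_of_le hy (h.1 hu)
    exact ⟨q.append q'.reverse, by simp [hq, hq']⟩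
  · obtain ⟨q, hq⟩ := R.exists_walk_of_not_le hy hu
    obtain ⟨q', hq'⟩ := R.exists_walk_of_not_le hy (fun hv => hu (h.2 hv))
    exact ⟨q.append q'.reverse, by simp [hq, hq']⟩

theorem reachable_of_le {u v : V} (h : R.le u v) : G.Reachable u v := by
  induction h with
  | refl => exact .rfl
  | tail _ h2 ih =>
    obtain ⟨h3, rfl⟩ := h2
    exact ih.trans (R.adj_parent h3).reachable

theorem isTree (R : Rooting G r) : G.IsTree := by
  have : Nonempty V := ⟨r⟩
  refine ⟨⟨fun u v => (R.reachable_of_le (R.le_root u)).trans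
    (R.reachable_of_le (R.le_root v)).symm⟩, ?_⟩
  rw [SimpleGraph.isAcyclic_iff_forall_adj_isBridge]
  have key : ∀ y, y ≠ r → G.IsBridge s(y, R.p y) := by
    intro y hy
    rw [SimpleGraph.isBridge_iff, SimpleGraph.reachable_deleteEdges_iff_exists_walk]
    rintro ⟨q, hq⟩
    exact R.not_parent_le hy ((R.le_iff_le_of_walk q hq).1 (R.le_refl y))
  intro a b hab
  obtain ⟨y, hy, he⟩ := R.exists_edge (e := s(a, b)) hab
  exact he ▸ key y hy

theorem mem_edges_iff {u v y : V} (hy : y ≠ r) {q : G.Walk u v}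
    (hq : q.IsPath) : s(y, R.p y) ∈ q.edges ↔ ¬ (R.le u y ↔ R.le v y) := by
  classical
  refine ⟨fun h h' => ?_, fun h => by_contra fun h' => h (R.le_iff_le_of_walk q h')⟩
  obtain ⟨q', hq'⟩ := R.exists_walk hy h'
  have := (R.isTree.existsUnique_path u v).unique hq q'.bypass_isPath
  rw [this] at h
  exact hq' (q'.edges_bypass_subset_edges h)

end Rooting

theorem SimpleGraph.IsTree.exists_rooting {V : Type*} {G : SimpleGraph V} (hG : G.IsTree) (r : V) :
    Nonempty (Rooting G r) := by
  classical
  choose f hf hu using fun x => hG.existsUnique_path x r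
  have key : ∀ x y, G.Adj x y → (x ≠ r ∧ (f x).snd = y) ∨ (y ≠ r ∧ (f y).snd = x) := by
    intro x y hxy
    by_cases h : y ∈ (f x).support
    · refine Or.inl ⟨?_, (hG.isAcyclic.eq_snd_of_adj_start (hf x) hxy h).symm⟩
      rintro rfl
      have : f x = .nil := ((hu x) _ .nil).symm
      rw [this] at h
      simp only [SimpleGraph.Walk.support_nil, List.mem_singleton] at h
      exact hxy.ne h.symm
    · have h1 : f y = .cons hxy.symm (f x) := ((hu y) _ ((hf x).cons h)).symm
      refine Or.inr ⟨?_, by rw [h1]; simp⟩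
      rintro rfl
      exact h (SimpleGraph.Walk.end_mem_support _)
  have hnil : ∀ x, x ≠ r → ¬ (f x).Nil := fun x hx h => hx h.eq
  refine ⟨⟨fun x => (f x).snd, fun x => (f x).length, fun x y => ⟨key x y, ?_⟩, fun x hx => ?_⟩⟩
  · rintro (⟨h, rfl⟩ | ⟨h, rfl⟩)
    · exact (f x).adj_snd (hnil x h)
    · exact ((f y).adj_snd (hnil y h)).symm
  · have h1 : (f x).tail = f (f x).snd := hu _ _ (hf x).tail
    have h2 := (f x).length_tail_add_one (hnil x hx)
    rw [h1] at h2
    omega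

namespace Rooting

variable {V : Type*} {G : SimpleGraph V} {r : V} (R : Rooting G r)

theorem exists_child {x y : V} (h : R.le x y) (hne : x ≠ y) :
    ∃ z, z ≠ r ∧ R.p z = y ∧ R.le x z := by
  rcases Relation.ReflTransGen.cases_tail h with h | ⟨z, h1, h2, h3⟩
  · exact (hne h.symm).elim
  · exact ⟨z, h2, h3, h1⟩

theorem not_le_of_siblings {a b : V} (hb : b ≠ r) (hab : a ≠ b)
    (hp : R.p a = R.p b) : ¬ R.le a b := fun h => by
  have := ((R.le_iff.1 h).resolve_left hab).2
  rw [hp] at this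
  exact R.not_parent_le hb this

theorem ne_parent {y : V} (hy : y ≠ r) : y ≠ R.p y := (R.adj_parent hy).ne

end Rooting

namespace WTree

variable {n : ℕ} (T : WTree n)

instance : Fintype T.V := T.fintypeV

variable {T} {r : T.V} (R : Rooting T.G r)

theorem mem_pathEdges_iff {u v y : T.V} (hy : y ≠ r) :
    s(y, R.p y) ∈ T.pathEdges u v ↔ ¬ (R.le u y ↔ R.le v y) := by
  constructor
  · rintro ⟨q, hq, h⟩
    exact (R.mem_edges_iff hy hq).1 h
  · intro h
    obtain ⟨q, hq, -⟩ := T.isTree.existsUnique_path u v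
    exact ⟨q, hq, (R.mem_edges_iff hy hq).2 h⟩

open Classical in
/-- The leaves that descend from `y`. -/
noncomputable def cluster (y : T.V) : Finset (Fin n) :=
  Finset.univ.filter fun i => R.le (T.leaf i) y

theorem mem_cluster {y : T.V} {i : Fin n} : i ∈ cluster R y ↔ R.le (T.leaf i) y := by
  simp [cluster]

theorem mem_subtreeEdges_iff {I : Finset (Fin n)} {y : T.V} (hy : y ≠ r) :
    s(y, R.p y) ∈ T.subtreeEdges I ↔ (cluster R y).Splits I := by
  simp only [subtreeEdges, Set.mem_ofPred_eq, mem_pathEdges_iff R hy, Finset.Splits, mem_cluster,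
    Finset.mem_coe]
  grind

open Classical in
/-- The total weight of the edges whose lower side is `C`. -/
noncomputable def clusterWeight (C : Finset (Fin n)) : ℝ :=
  ∑ y, if y ≠ r ∧ cluster R y = C then T.w s(y, R.p y) else 0

open Classical in
theorem D_eq_splitSum (I : Finset (Fin n)) : T.D I = splitSum (clusterWeight R) I := by
  have h1 : T.subtreeEdges I =
      (fun y => s(y, R.p y)) '' {y | y ≠ r ∧ (cluster R y).Splits I} := by
    ext e
    constructor
    · intro he
      have hE : e ∈ T.G.edgeSet := by
        obtain ⟨i, _, j, _, q, _, h⟩ := he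
        exact q.edges_subset_edgeSet h
      obtain ⟨y, hy, rfl⟩ := R.exists_edge hE
      exact ⟨y, ⟨hy, (mem_subtreeEdges_iff R hy).1 he⟩, rfl⟩
    · rintro ⟨y, ⟨hy, h⟩, rfl⟩
      exact (mem_subtreeEdges_iff R hy).2 h
  rw [D, h1, finsum_mem_image fun x hx y hy h => R.edge_inj hx.1 hy.1 h,
    finsum_eq_sum_of_fintype]
  unfold splitSum clusterWeight
  have h2 : ∀ S : Finset (Fin n), (if S.Splits I then
      ∑ y, (if y ≠ r ∧ cluster R y = S then T.w s(y, R.p y) else 0) else 0) =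
      ∑ y, if cluster R y = S then
        (if y ≠ r ∧ (cluster R y).Splits I then T.w s(y, R.p y) else 0) else 0 := by
    intro S
    split_ifs with h
    · refine Finset.sum_congr rfl fun y _ => ?_
      by_cases hy : cluster R y = S
      · simp [hy, h]
      · simp [hy]
    · refine (Finset.sum_eq_zero fun y _ => ?_).symm
      by_cases hy : cluster R y = S
      · simp [hy, h]
      · simp [hy]
  rw [Finset.sum_congr rfl fun S _ => h2 S, Finset.sum_comm]
  refine Finset.sum_congr rfl fun y _ => ?_
  rw [Finset.sum_ite_eq]
  simp [finsum_eq_if]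

theorem sideLeaves_self {y : T.V} (hy : y ≠ r) : T.sideLeaves s(y, R.p y) y = cluster R y := by
  ext i
  simp [sideLeaves, mem_pathEdges_iff R hy, mem_cluster, R.le_refl]

theorem sideLeaves_parent {y : T.V} (hy : y ≠ r) :
    T.sideLeaves s(y, R.p y) (R.p y) = ((cluster R y)ᶜ : Finset (Fin n)) := by
  ext i
  simp [sideLeaves, mem_pathEdges_iff R hy, mem_cluster, R.not_parent_le hy]

theorem isPseudostar_iff {k : ℕ} : T.IsPseudostar k ↔
    ∀ y, y ≠ r → k ≤ (cluster R y).card ∨ k ≤ (cluster R y)ᶜ.card := by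
  have key : ∀ y, y ≠ r → ((k ≤ (T.sideLeaves s(y, R.p y) y).ncard ∨
      k ≤ (T.sideLeaves s(y, R.p y) (R.p y)).ncard) ↔
      (k ≤ (cluster R y).card ∨ k ≤ (cluster R y)ᶜ.card)) := by
    intro y hy
    rw [sideLeaves_self R hy, sideLeaves_parent R hy, Set.ncard_coe_finset, Set.ncard_coe_finset]
  constructor
  · intro h y hy
    exact (key y hy).1 (h _ _ (R.adj_parent hy))
  · intro h a b hab
    rcases (R.adj_iff a b).1 hab with ⟨ha, rfl⟩ | ⟨hb, rfl⟩
    · exact (key a ha).2 (h a ha)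
    · rw [Sym2.eq_swap, or_comm]
      exact (key b hb).2 (h b hb)

theorem cluster_mono {y z : T.V} (h : R.le y z) : cluster R y ⊆ cluster R z := fun i hi => by
  rw [mem_cluster] at hi ⊢
  exact R.le_trans hi h

theorem cluster_root : cluster R r = Finset.univ := by
  ext i
  simp [mem_cluster, R.le_root]

theorem comparable_of_mem {y z : T.V} {i : Fin n} (h1 : i ∈ cluster R y) (h2 : i ∈ cluster R z) :
    R.le y z ∨ R.le z y :=
  R.le_total ((mem_cluster R).1 h1) ((mem_cluster R).1 h2)

theorem eq_of_adj_leaf {i : Fin n} {a b : T.V} (ha : T.G.Adj (T.leaf i) a)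
    (hb : T.G.Adj (T.leaf i) b) : a = b := by
  obtain ⟨c, hc⟩ := Set.ncard_eq_one.1 ((T.leafSpec (T.leaf i)).2 ⟨i, rfl⟩)
  have h1 : a ∈ T.G.neighborSet (T.leaf i) := ha
  have h2 : b ∈ T.G.neighborSet (T.leaf i) := hb
  rw [hc] at h1 h2
  exact h1.trans h2.symm

theorem parent_ne_leaf {i : Fin n} (hi : T.leaf i ≠ r) {z : T.V} (hz : z ≠ r) :
    R.p z ≠ T.leaf i := fun h => by
  have h1 : T.G.Adj (T.leaf i) z := h ▸ (R.adj_parent hz).symm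
  have h2 := eq_of_adj_leaf h1 (R.adj_parent hi)
  have h3 := R.h_lt z hz
  have h4 := R.h_lt _ hi
  rw [h] at h3
  rw [← h2] at h4
  omega

theorem eq_leaf_of_le {i : Fin n} (hi : T.leaf i ≠ r) {x : T.V} (h : R.le x (T.leaf i)) :
    x = T.leaf i := by
  by_contra hne
  obtain ⟨z, hz, hp, -⟩ := R.exists_child h hne
  exact parent_ne_leaf R hi hz hp

theorem cluster_leaf {i : Fin n} (hi : T.leaf i ≠ r) : cluster R (T.leaf i) = {i} := by
  ext j
  rw [mem_cluster, Finset.mem_singleton]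
  exact ⟨fun h => T.leafInj (eq_leaf_of_le R hi h), fun h => h ▸ R.le_refl _⟩

theorem neighborSet_eq {y : T.V} (hy : y ≠ r) :
    T.G.neighborSet y = insert (R.p y) {z | z ≠ r ∧ R.p z = y} := by
  ext z
  simp only [SimpleGraph.mem_neighborSet, R.adj_iff, Set.mem_insert_iff, Set.mem_ofPred_eq]
  grind

theorem cluster_nonempty {y : T.V} (hy : y ≠ r) : (cluster R y).Nonempty := by
  classical
  obtain ⟨x, hx, hmax⟩ := Finset.exists_max_image (Finset.univ.filter fun x => R.le x y) R.h
    ⟨y, by simp [R.le_refl]⟩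
  simp only [Finset.mem_filter, Finset.mem_univ, true_and] at hx hmax
  have hxr : x ≠ r := fun h => hy (R.root_le (h ▸ hx))
  have h1 : {z | z ≠ r ∧ R.p z = x} = ∅ := by
    ext z
    simp only [Set.mem_ofPred_eq, Set.mem_empty_iff_false, iff_false, not_and]
    rintro hz rfl
    have := hmax z (R.le_trans (R.le_parent hz) hx)
    have := R.h_lt z hz
    omega
  have h2 := neighborSet_eq R hxr
  rw [h1] at h2
  obtain ⟨i, rfl⟩ := (T.leafSpec x).1 (by rw [h2]; simp)
  exact ⟨i, (mem_cluster R).2 hx⟩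

end WTree

namespace WTree

variable {n : ℕ} {T : WTree n} {i₀ : Fin n} (R : Rooting T.G (T.leaf i₀))

theorem notMem_cluster {y : T.V} (hy : y ≠ T.leaf i₀) : i₀ ∉ cluster R y := fun h =>
  hy (R.root_le ((mem_cluster R).1 h))

theorem leaf_ne {i : Fin n} (hi : i ≠ i₀) : T.leaf i ≠ T.leaf i₀ := fun h => hi (T.leafInj h)

theorem cluster_eq_compl_of_parent {a : T.V} (ha : a ≠ T.leaf i₀) (hp : R.p a = T.leaf i₀) :
    cluster R a = {i₀}ᶜ := by
  ext i
  rw [Finset.mem_compl, Finset.mem_singleton]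
  refine ⟨fun h h' => notMem_cluster R ha (h' ▸ h), fun h => ?_⟩
  obtain ⟨z, hz, hz', hle⟩ := R.exists_child (R.le_root (T.leaf i)) (leaf_ne h)
  have := eq_of_adj_leaf (hz' ▸ (R.adj_parent hz).symm) (hp ▸ (R.adj_parent ha).symm)
  rw [mem_cluster, ← this]
  exact hle

theorem exists_root_child : ∃ a, a ≠ T.leaf i₀ ∧ R.p a = T.leaf i₀ := by
  obtain ⟨c, hc⟩ := Set.ncard_eq_one.1 ((T.leafSpec (T.leaf i₀)).2 ⟨i₀, rfl⟩)
  have h1 : T.G.Adj (T.leaf i₀) c := by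
    rw [← SimpleGraph.mem_neighborSet, hc]; rfl
  have h2 := (R.adj_iff _ _).1 h1
  simp only [ne_eq, not_true_eq_false, false_and, false_or] at h2
  exact ⟨c, h2⟩

theorem exists_sibling (hT : T.Essential) {a : T.V} (ha : a ≠ T.leaf i₀)
    (hp : R.p a ≠ T.leaf i₀) : ∃ b, b ≠ T.leaf i₀ ∧ R.p b = R.p a ∧ b ≠ a := by
  by_contra! hcon
  have h1 : {z | z ≠ T.leaf i₀ ∧ R.p z = R.p a} = {a} := by
    ext z
    exact ⟨fun h => hcon z h.1 h.2, by rintro rfl; exact ⟨ha, rfl⟩⟩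
  have h2 := neighborSet_eq R hp
  rw [h1] at h2
  refine hT (R.p a) ?_
  rw [deg, h2, Set.ncard_pair]
  intro h
  have h3 := R.h_lt _ ha
  have h4 := R.h_lt _ hp
  rw [h] at h4
  omega

theorem cluster_ne_of_le (hT : T.Essential) {y z : T.V} (h : R.le y z) (hne : y ≠ z) :
    cluster R y ≠ cluster R z := by
  intro heq
  obtain ⟨a, ha, rfl, hya⟩ := R.exists_child h hne
  by_cases hz : R.p a = T.leaf i₀
  · have hy : y ≠ T.leaf i₀ := fun h' => ha (R.root_le (h' ▸ hya))
    refine notMem_cluster R hy ?_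
    rw [heq, hz, cluster_root]
    simp
  · obtain ⟨b, hb, hp, hba⟩ := exists_sibling R hT ha hz
    obtain ⟨i, hi⟩ := cluster_nonempty R hb
    have h1 : i ∈ cluster R (R.p a) := hp ▸ cluster_mono R (R.le_parent hb) hi
    rw [← heq] at h1
    rcases comparable_of_mem R hi (cluster_mono R hya h1) with h | h
    · exact R.not_le_of_siblings ha hba hp h
    · exact R.not_le_of_siblings hb hba.symm hp.symm h

theorem cluster_nonempty' (y : T.V) : (cluster R y).Nonempty := by
  by_cases hy : y = T.leaf i₀
  · exact ⟨i₀, by rw [hy, cluster_root]; simp⟩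
  · exact cluster_nonempty R hy

theorem cluster_subset_iff (hT : T.Essential) {y z : T.V} :
    cluster R y ⊆ cluster R z ↔ R.le y z := by
  refine ⟨fun h => ?_, cluster_mono R⟩
  obtain ⟨i, hi⟩ := cluster_nonempty' R y
  rcases comparable_of_mem R hi (h hi) with h' | h'
  · exact h'
  · by_contra hne
    exact cluster_ne_of_le R hT h' (fun h'' => hne (h'' ▸ R.le_refl _))
      (le_antisymm (cluster_mono R h') h)

theorem cluster_injective (hT : T.Essential) : Function.Injective (cluster R) := fun _ _ h =>
  R.le_antisymm ((cluster_subset_iff R hT).1 h.le) ((cluster_subset_iff R hT).1 h.ge)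

theorem clusterWeight_cluster (hT : T.Essential) {y : T.V} (hy : y ≠ T.leaf i₀) :
    clusterWeight R (cluster R y) = T.w s(y, R.p y) := by
  classical
  rw [clusterWeight, Finset.sum_eq_single y]
  · simp [hy]
  · intro z _ hz
    have : cluster R z ≠ cluster R y := fun h => hz (cluster_injective R hT h)
    simp [this]
  · simp

theorem exists_of_clusterWeight_ne_zero {C : Finset (Fin n)} (h : clusterWeight R C ≠ 0) :
    ∃ y, y ≠ T.leaf i₀ ∧ cluster R y = C := by
  classical
  obtain ⟨y, _, hy⟩ := Finset.exists_ne_zero_of_sum_ne_zero h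
  by_contra! hcon
  exact hy (if_neg fun h => hcon y h.1 h.2)

theorem clusterWeight_eq_zero_of_mem {C : Finset (Fin n)} (h : i₀ ∈ C) :
    clusterWeight R C = 0 := by
  by_contra hne
  obtain ⟨y, hy, rfl⟩ := exists_of_clusterWeight_ne_zero R hne
  exact notMem_cluster R hy h

theorem clusterWeight_empty : clusterWeight R ∅ = 0 := by
  by_contra hne
  obtain ⟨y, hy, h⟩ := exists_of_clusterWeight_ne_zero R hne
  exact (cluster_nonempty R hy).ne_empty h

/-- The clusters of a rooted tree form a split system. -/
theorem isSplitSystem : IsSplitSystem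
    {S | (∃ y, y ≠ T.leaf i₀ ∧ cluster R y = S) ∨ ∃ y, y ≠ T.leaf i₀ ∧ cluster R y = Sᶜ} where
  compl_mem S hS := by
    simpa [or_comm] using hS
  compat S hS S' hS' := by
    have key : ∀ y z, (∀ x ∈ cluster R y, x ∉ cluster R z) ∨
        (∀ x ∈ cluster R y, x ∈ cluster R z) ∨ (∀ x ∈ cluster R z, x ∈ cluster R y) := by
      intro y z
      by_cases h : ∃ x ∈ cluster R y, x ∈ cluster R z
      · obtain ⟨x, hx, hx'⟩ := h
        exact Or.inr ((comparable_of_mem R hx hx').imp (fun h => cluster_mono R h)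
          fun h => cluster_mono R h)
      · push Not at h
        exact Or.inl h
    have hi : ∀ y, y ≠ T.leaf i₀ → i₀ ∉ cluster R y := fun y hy => notMem_cluster R hy
    unfold Finset.SplitCompat
    rcases hS with ⟨y, hy, h⟩ | ⟨y, hy, h⟩ <;> rcases hS' with ⟨z, hz, h'⟩ | ⟨z, hz, h'⟩ <;>
      have h1 := key y z <;> have h2 := hi y hy <;> have h3 := hi z hz <;>
      rw [h, h'] at h1 <;> rw [h] at h2 <;> rw [h'] at h3 <;>
      try simp only [Finset.mem_compl] at h1 h2 h3
    all_goals grind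

theorem exists_leaf_mem_of_isTwigEdge (hT : T.Essential) {e : Sym2 T.V} (he : T.IsTwigEdge e) :
    ∃ i, T.leaf i ∈ e := by
  obtain ⟨i, v, -, q, hq, hu, heq⟩ := he
  refine ⟨i, ?_⟩
  cases q with
  | nil => simp at heq
  | @cons _ x _ h q =>
    rw [SimpleGraph.Walk.edges_cons, List.mem_cons] at heq
    rcases heq with rfl | heq
    · simp
    · cases q with
      | nil => simp at heq
      | @cons _ z _ h' q =>
        exfalso
        rw [SimpleGraph.Walk.cons_isPath_iff, SimpleGraph.Walk.cons_isPath_iff] at hq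
        obtain ⟨⟨-, h2⟩, h3⟩ := hq
        have hz : T.leaf i ≠ z := fun h => h3 (by simp [h])
        have h4 : ({T.leaf i, z} : Set T.V) ⊆ T.G.neighborSet x := by
          rintro a (rfl | rfl)
          · exact h.symm
          · exact h'
        have h5 := Set.ncard_le_ncard h4 (Set.toFinite _)
        rw [Set.ncard_pair hz] at h5
        have h6 : T.IsNode x := lt_of_le_of_ne h5 (hT x).symm
        have h7 := hu x (by simp) h6
        exact h2 (by rw [h7]; exact q.end_mem_support)

theorem weight_ne_zero (hT : T.Essential) (hT' : T.InternalNonzero) {y : T.V}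
    (hy : y ≠ T.leaf i₀) (h1 : ∀ i, cluster R y ≠ {i}) (h2 : cluster R y ≠ {i₀}ᶜ) :
    T.w s(y, R.p y) ≠ 0 := by
  refine hT' _ (R.edge_mem hy) fun htw => ?_
  obtain ⟨i, hi⟩ := exists_leaf_mem_of_isTwigEdge hT htw
  rcases Sym2.mem_iff.1 hi with h | h
  · refine h1 i ?_
    rw [← h]
    exact cluster_leaf R (h ▸ hy)
  · by_cases hi₀ : i = i₀
    · subst hi₀
      exact h2 (cluster_eq_compl_of_parent R hy h.symm)
    · exact parent_ne_leaf R (leaf_ne hi₀) hy h.symm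

/-- The clusters of an internal-nonzero-weighted essential tree are determined by the weights. -/
theorem exists_cluster_eq {T' : WTree n} (R' : Rooting T'.G (T'.leaf i₀)) (hT : T.Essential)
    (hT' : T.InternalNonzero) (h : clusterWeight R = clusterWeight R') (y : T.V) :
    ∃ y', cluster R' y' = cluster R y := by
  by_cases hy : y = T.leaf i₀
  · exact ⟨T'.leaf i₀, by rw [hy, cluster_root, cluster_root]⟩
  by_cases h1 : ∃ i, cluster R y = {i}
  · obtain ⟨i, hi⟩ := h1
    have : i ≠ i₀ := by
      rintro rfl
      exact notMem_cluster R hy (by simp [hi])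
    exact ⟨T'.leaf i, by rw [cluster_leaf R' (leaf_ne this), hi]⟩
  by_cases h2 : cluster R y = {i₀}ᶜ
  · obtain ⟨a, ha, hp⟩ := exists_root_child R'
    exact ⟨a, by rw [cluster_eq_compl_of_parent R' ha hp, h2]⟩
  push Not at h1
  have h3 := weight_ne_zero R hT hT' hy h1 h2
  rw [← clusterWeight_cluster R hT hy, h] at h3
  obtain ⟨y', -, hy'⟩ := exists_of_clusterWeight_ne_zero R' h3
  exact ⟨y', hy'⟩

theorem isom_of_clusterWeight_eq {T' : WTree n} (R' : Rooting T'.G (T'.leaf i₀))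
    (hT : T.Essential) (hTn : T.InternalNonzero) (hT' : T'.Essential) (hTn' : T'.InternalNonzero)
    (h : clusterWeight R = clusterWeight R') : T.Isom T' := by
  choose f hf using exists_cluster_eq R R' hT hTn h
  choose g hg using exists_cluster_eq R' R hT' hTn' h.symm
  let φ : T.V ≃ T'.V :=
    { toFun := f
      invFun := g
      left_inv := fun y => cluster_injective R hT (by rw [hg, hf])
      right_inv := fun y => cluster_injective R' hT' (by rw [hf, hg]) }
  have hφ : ∀ y, cluster R' (φ y) = cluster R y := hf
  have hle : ∀ y z, R'.le (φ y) (φ z) ↔ R.le y z := fun y z => by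
    rw [← cluster_subset_iff R hT, ← cluster_subset_iff R' hT', hφ, hφ]
  have hroot : φ (T.leaf i₀) = T'.leaf i₀ :=
    cluster_injective R' hT' (by rw [hφ, cluster_root, cluster_root])
  have hne : ∀ y, φ y ≠ T'.leaf i₀ ↔ y ≠ T.leaf i₀ := fun y => by
    rw [← hroot, Ne, Ne, φ.apply_eq_iff_eq]
  have hp : ∀ y, y ≠ T.leaf i₀ → R'.p (φ y) = φ (R.p y) := by
    intro y hy
    have hy' := (hne y).2 hy
    apply R'.le_antisymm
    · have h1 := (hle _ _).2 (R.le_parent hy)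
      exact ((R'.le_iff.1 h1).resolve_left fun h => R.ne_parent hy (φ.injective h)).2
    · obtain ⟨z, hz⟩ := φ.surjective (R'.p (φ y))
      have h1 := R'.le_parent hy'
      rw [← hz, hle] at h1
      rw [← hz, hle]
      refine ((R.le_iff.1 h1).resolve_left ?_).2
      rintro rfl
      exact R'.ne_parent hy' hz
  have hadj : ∀ a b, T.G.Adj a b ↔ T'.G.Adj (φ a) (φ b) := by
    intro a b
    rw [R.adj_iff, R'.adj_iff, hne, hne]
    have h1 : ∀ a b, (a ≠ T.leaf i₀ ∧ R.p a = b) ↔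
        (a ≠ T.leaf i₀ ∧ R'.p (φ a) = φ b) := fun a b =>
      and_congr_right fun ha => by rw [hp a ha, φ.apply_eq_iff_eq]
    rw [h1 a b, h1 b a]
  refine ⟨φ, hadj, fun i => ?_, ?_⟩
  · by_cases hi : i = i₀
    · rw [hi, hroot]
    · exact cluster_injective R' hT' (by
        rw [hφ, cluster_leaf R (leaf_ne hi), cluster_leaf R' (leaf_ne hi)])
  · have key : ∀ y, y ≠ T.leaf i₀ → T.w s(y, R.p y) = T'.w s(φ y, φ (R.p y)) := by
      intro y hy
      rw [← hp y hy, ← clusterWeight_cluster R hT hy,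
        ← clusterWeight_cluster R' hT' ((hne y).2 hy), hφ, h]
    intro a b
    by_cases hab : T.G.Adj a b
    · rcases (R.adj_iff a b).1 hab with ⟨ha, rfl⟩ | ⟨hb, rfl⟩
      · exact key a ha
      · rw [Sym2.eq_swap, key b hb, Sym2.eq_swap]
    · rw [T.wSupport _ hab, T'.wSupport _ fun h => hab ((hadj a b).2 h)]

/-- The weights of two pseudostars with the same `k`-weights agree. -/
theorem clusterWeight_eq_of_D_eq {k : ℕ} (h3 : 3 ≤ k) (hk : k + 1 ≤ n) {T' : WTree n}
    (R' : Rooting T'.G (T'.leaf i₀)) (hT : T.IsPseudostar k) (hT' : T'.IsPseudostar k)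
    (h : ∀ I : Finset (Fin n), I.card = k → T.D I = T'.D I) :
    clusterWeight R = clusterWeight R' := by
  classical
  set d₀ : Finset (Fin n) → ℝ := fun S => clusterWeight R S - clusterWeight R' S with hd₀
  have hs : ∀ I : Finset (Fin n), I.card = k → splitSum d₀ I = 0 := by
    intro I hI
    have h1 := h I hI
    rw [D_eq_splitSum R, D_eq_splitSum R'] at h1
    rw [← sub_eq_zero.2 h1]
    unfold splitSum
    rw [← Finset.sum_sub_distrib]
    refine Finset.sum_congr rfl fun S _ => ?_
    split_ifs <;> simp [hd₀]
  have hs' : ∀ I, splitSum (fun S => d₀ Sᶜ) I = splitSum d₀ I := by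
    intro I
    unfold splitSum
    refine Fintype.sum_equiv (Equiv.mk compl compl compl_compl compl_compl) _ _ fun S => ?_
    exact if_congr (by simp [Finset.Splits, and_comm]) rfl rfl
  have hd₀' : ∀ S, d₀ S ≠ 0 → clusterWeight R S ≠ 0 ∨ clusterWeight R' S ≠ 0 := by
    intro S hS
    by_contra! hcon
    exact hS (by simp [hd₀, hcon.1, hcon.2])
  have hsplit : ∀ S, d₀ S + d₀ Sᶜ ≠ 0 → d₀ S ≠ 0 ∨ d₀ Sᶜ ≠ 0 := by
    intro S hS
    by_contra! hcon
    exact hS (by simp [hcon.1, hcon.2])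
  have hmem : ∀ S, d₀ S ≠ 0 →
      (∃ y, y ≠ T.leaf i₀ ∧ cluster R y = S) ∨ ∃ y, y ≠ T'.leaf i₀ ∧ cluster R' y = S :=
    fun S hS => (hd₀' S hS).imp (exists_of_clusterWeight_ne_zero R)
      (exists_of_clusterWeight_ne_zero R')
  have hbig₀ : ∀ S, d₀ S ≠ 0 → k ≤ S.card ∨ k ≤ Sᶜ.card := by
    intro S hS
    rcases hmem S hS with ⟨y, hy, rfl⟩ | ⟨y, hy, rfl⟩
    · exact (isPseudostar_iff R).1 hT y hy
    · exact (isPseudostar_iff R').1 hT' y hy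
  have hin : ∀ S, i₀ ∈ S → d₀ S = 0 := fun S hS => by
    simp [hd₀, clusterWeight_eq_zero_of_mem R hS, clusterWeight_eq_zero_of_mem R' hS]
  have hz := eq_zero_of_splitSum_eq_zero h3 (by simpa) (d := fun S => d₀ S + d₀ Sᶜ)
    (fun S => by rw [compl_compl, add_comm])
    (by
      rw [Finset.compl_empty, hin _ (Finset.mem_univ _)]
      simp [hd₀, clusterWeight_empty])
    (fun I hI => by
      have h1 : splitSum (fun S => d₀ S + d₀ Sᶜ) I =
          splitSum d₀ I + splitSum (fun S => d₀ Sᶜ) I := by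
        unfold splitSum
        rw [← Finset.sum_add_distrib]
        refine Finset.sum_congr rfl fun S _ => ?_
        split_ifs <;> simp
      rw [h1, hs', hs I hI, add_zero])
    (isSplitSystem R) (isSplitSystem R')
    (fun S hS => by
      simp only [Set.mem_ofPred_eq]
      rcases hsplit S hS with h | h
      · exact (hmem S h).imp Or.inl Or.inl
      · exact (hmem Sᶜ h).imp Or.inr Or.inr)
    (fun S hS => by
      rcases hsplit S hS with h | h
      · exact hbig₀ S h
      · have := hbig₀ Sᶜ h
        rwa [compl_compl, or_comm] at this)
  funext S
  by_cases hS : i₀ ∈ S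
  · rw [clusterWeight_eq_zero_of_mem R hS, clusterWeight_eq_zero_of_mem R' hS]
  · have h1 := congrFun hz S
    simp only [hin Sᶜ (by simpa), add_zero, Pi.zero_apply] at h1
    exact sub_eq_zero.1 h1

end WTree

namespace Rooting

variable {V : Type*} {G : SimpleGraph V} {r : V} (R : Rooting G r)

theorem exists_weight (f : V → ℝ) : ∃ w : Sym2 V → ℝ,
    (∀ y, y ≠ r → w s(y, R.p y) = f y) ∧ ∀ e, e ∉ G.edgeSet → w e = 0 := by
  classical
  refine ⟨fun e => if h : ∃ y, y ≠ r ∧ e = s(y, R.p y) then f h.choose else 0, ?_, ?_⟩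
  · intro y hy
    have h : ∃ z, z ≠ r ∧ s(y, R.p y) = s(z, R.p z) := ⟨y, hy, rfl⟩
    simp only [dif_pos h]
    rw [← R.edge_inj hy h.choose_spec.1 h.choose_spec.2]
  · rintro e he
    refine dif_neg ?_
    rintro ⟨y, hy, rfl⟩
    exact he (R.edge_mem hy)

end Rooting

/-- A family of pairwise nested or disjoint subsets of `Fin n` describing a tree rooted at the
leaf `i₀`. -/
structure IsHierarchy {n : ℕ} (i₀ : Fin n) (L : Set (Finset (Fin n))) : Prop where
  univ_mem : Finset.univ ∈ L
  compl_mem : {i₀}ᶜ ∈ L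
  singleton_mem : ∀ i, i ≠ i₀ → {i} ∈ L
  nonempty : ∀ C ∈ L, C.Nonempty
  eq_univ : ∀ C ∈ L, i₀ ∈ C → C = Finset.univ
  nested : ∀ C ∈ L, ∀ C' ∈ L, ∀ x ∈ C, x ∈ C' → C ⊆ C' ∨ C' ⊆ C

namespace IsHierarchy

variable {n : ℕ} {i₀ : Fin n} {L : Set (Finset (Fin n))}

theorem exists_parent (hL : IsHierarchy i₀ L) (x : L) : ∃ y : L, x.1 ≠ Finset.univ →
    x.1 ⊂ y.1 ∧ ∀ z : L, x.1 ⊂ z.1 → y.1 ⊆ z.1 := by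
  classical
  by_cases hx : x.1 = Finset.univ
  · exact ⟨x, fun h => (h hx).elim⟩
  obtain ⟨y, hy, hmin⟩ := Finset.exists_min_image
    (Finset.univ.filter fun y => y ∈ L ∧ x.1 ⊂ y) Finset.card
    ⟨Finset.univ, by simpa [hL.univ_mem, Finset.ssubset_univ_iff] using hx⟩
  simp only [Finset.mem_filter, Finset.mem_univ, true_and] at hy hmin
  refine ⟨⟨y, hy.1⟩, fun _ => ⟨hy.2, fun z hz => ?_⟩⟩
  obtain ⟨i, hi⟩ := hL.nonempty x.1 x.2
  rcases hL.nested y hy.1 z.1 z.2 i (hy.2.1 hi) (hz.1 hi) with h | h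
  · exact h
  · exact (Finset.eq_of_subset_of_card_le h (hmin z.1 ⟨z.2, hz⟩)).ge

/-- The tree of a hierarchy, ordered by inclusion. -/
theorem exists_rooting (hL : IsHierarchy i₀ L) : ∃ (G : SimpleGraph L) (r : L) (R : Rooting G r),
    r.1 = Finset.univ ∧ ∀ x y, R.le x y ↔ x.1 ⊆ y.1 := by
  choose p hp using hL.exists_parent
  set r : L := ⟨Finset.univ, hL.univ_mem⟩ with hr
  have hne : ∀ x : L, x ≠ r ↔ x.1 ≠ Finset.univ := fun x => by
    rw [hr, Ne, Ne, Subtype.ext_iff]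
  have hcard : ∀ x, x ≠ r → n - (p x).1.card < n - x.1.card := by
    intro x hx
    have h1 := Finset.card_lt_card (hp x ((hne x).1 hx)).1
    have h2 := Finset.card_le_univ (p x).1
    rw [Fintype.card_fin] at h2
    omega
  let G : SimpleGraph L :=
    { Adj := fun x y => (x ≠ r ∧ p x = y) ∨ (y ≠ r ∧ p y = x)
      symm := ⟨fun x y h => h.symm⟩
      loopless := ⟨fun x h => by
        have h' := h.elim id id
        have := hcard x h'.1
        rw [h'.2] at this
        omega⟩ }
  let R : Rooting G r := ⟨p, fun x => n - x.1.card, fun x y => Iff.rfl, hcard⟩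
  refine ⟨G, r, R, rfl, fun x y => ⟨fun h => ?_, fun h => ?_⟩⟩
  · induction h with
    | refl => exact subset_rfl
    | tail _ h ih =>
      obtain ⟨h1, rfl⟩ := h
      exact ih.trans (hp _ ((hne _).1 h1)).1.1
  · induction hm : R.h x using Nat.strong_induction_on generalizing x with
    | _ m ih =>
      by_cases hxy : x = y
      · exact hxy ▸ R.le_refl _
      · have h1 : x.1 ⊂ y.1 := lt_of_le_of_ne h fun h => hxy (Subtype.ext h)
        have h2 : x.1 ≠ Finset.univ := fun h => by
          rw [h] at h1
          exact h1.2 (Finset.subset_univ _)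
        have h3 := (hne x).2 h2
        exact R.le_iff.2 (Or.inr ⟨h3, ih _ (hm ▸ R.h_lt x h3) _ ((hp x h2).2 y h1) rfl⟩)

/-- Every hierarchy with prescribed weights comes from an essential weighted tree. -/
theorem exists_tree (hL : IsHierarchy i₀ L) (hn : 4 ≤ n) (a : Finset (Fin n) → ℝ) :
    ∃ (T : WTree n) (R : Rooting T.G (T.leaf i₀)), T.Essential ∧
      (∀ C, C ∈ L ↔ ∃ y, WTree.cluster R y = C) ∧
      ∀ y, y ≠ T.leaf i₀ → T.w s(y, R.p y) = a (WTree.cluster R y) := by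
  classical
  obtain ⟨G, r, R, hr, hle⟩ := hL.exists_rooting
  obtain ⟨w, hw, hw'⟩ := R.exists_weight fun x => a x.1
  have hne : ∀ x : L, x ≠ r ↔ x.1 ≠ Finset.univ := fun x => by
    rw [Ne, Ne, Subtype.ext_iff, hr]
  have hi₀ : ∀ x : L, x ≠ r → i₀ ∉ x.1 := fun x hx h => (hne x).1 hx (hL.eq_univ x.1 x.2 h)
  have hsub : ∀ x : L, x ≠ r → x.1 ⊂ (R.p x).1 := fun x hx =>
    lt_of_le_of_ne ((hle _ _).1 (R.le_parent hx)) fun h => R.ne_parent hx (Subtype.ext h)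
  let leaf : Fin n → L := fun i => if h : i = i₀ then r else ⟨{i}, hL.singleton_mem i h⟩
  have hleaf₀ : leaf i₀ = r := dif_pos rfl
  have hleaf : ∀ i, i ≠ i₀ → (leaf i).1 = {i} := fun i hi => by simp only [leaf, dif_neg hi]
  have hleafr : ∀ i, i ≠ i₀ → leaf i ≠ r := fun i hi => by
    rw [hne, hleaf i hi]
    intro h
    have := congrArg Finset.card h
    simp at this
    omega
  have hmem : ∀ i, ∀ x : L, R.le (leaf i) x ↔ i ∈ x.1 := by
    intro i x
    by_cases hi : i = i₀
    · rw [hi, hleaf₀]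
      refine ⟨fun h => by rw [R.root_le h, hr]; exact Finset.mem_univ _, fun h => ?_⟩
      by_contra h'
      exact hi₀ x (by rintro rfl; exact h' (R.le_refl _)) h
    · rw [hle, hleaf i hi, Finset.singleton_subset_iff]
  have hinj : Function.Injective leaf := by
    intro i j hij
    by_cases hi : i = i₀ <;> by_cases hj : j = i₀
    · rw [hi, hj]
    · rw [hi, hleaf₀] at hij
      exact (hleafr j hj hij.symm).elim
    · rw [hj, hleaf₀] at hij
      exact (hleafr i hi hij).elim
    · have := congrArg Subtype.val hij
      rw [hleaf i hi, hleaf j hj] at this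
      exact Finset.singleton_injective this
  have hcl : ∀ (x : L) (i : Fin n), i ∈ x.1 → i ≠ i₀ → x.1 ≠ {i} →
      ∃ z, z ≠ r ∧ R.p z = x ∧ i ∈ z.1 := by
    intro x i hi hii hx
    obtain ⟨z, hz, hp, hiz⟩ := R.exists_child ((hmem i x).2 hi) fun h => hx (h ▸ hleaf i hii)
    exact ⟨z, hz, hp, (hmem i z).1 hiz⟩
  -- internal vertices have at least three neighbours
  have hnode : ∀ x : L, x ∉ Set.range leaf → 3 ≤ (G.neighborSet x).ncard := by
    intro x hx
    have hxr : x ≠ r := fun h => hx ⟨i₀, by rw [h, hleaf₀]⟩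
    have hxs : ∀ i, x.1 ≠ {i} := by
      intro i hi
      have : i ≠ i₀ := by
        rintro rfl
        exact hi₀ x hxr (by rw [hi]; simp)
      exact hx ⟨i, Subtype.ext (by rw [hleaf i this, hi])⟩
    have hxi : ∀ i ∈ x.1, i ≠ i₀ := fun i hi h => hi₀ x hxr (h ▸ hi)
    obtain ⟨i, hi⟩ := hL.nonempty x.1 x.2
    obtain ⟨z, hz, hzp, hiz⟩ := hcl x i hi (hxi i hi) (hxs i)
    obtain ⟨j, hj, hjz⟩ := Finset.exists_of_ssubset (hzp ▸ hsub z hz)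
    obtain ⟨z', hz', hzp', hjz'⟩ := hcl x j hj (hxi j hj) (hxs j)
    have h1 : z ≠ z' := fun h => hjz (h ▸ hjz')
    have h2 : ∀ z, z ≠ r → R.p z = x → R.p x ≠ z := by
      rintro z hz hzp rfl
      have h1 := R.h_lt _ hz
      have h2 := R.h_lt _ hxr
      rw [hzp] at h1
      omega
    have h3 : ({R.p x, z, z'} : Set L) ⊆ G.neighborSet x := by
      rintro b (rfl | rfl | rfl)
      · exact R.adj_parent hxr
      · exact hzp ▸ (R.adj_parent hz).symm
      · exact hzp' ▸ (R.adj_parent hz').symm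
    have h4 := Set.ncard_le_ncard h3 (Set.toFinite _)
    rw [Set.ncard_eq_three.2 ⟨_, _, _, h2 z hz hzp, h2 z' hz' hzp', h1, rfl⟩] at h4
    exact h4
  have hleaf1 : ∀ i, (G.neighborSet (leaf i)).ncard = 1 := by
    intro i
    rw [Set.ncard_eq_one]
    by_cases hi : i = i₀
    · set t : L := ⟨{i₀}ᶜ, hL.compl_mem⟩ with ht
      have htr : t ≠ r := by
        rw [hne]
        intro h
        have := Finset.mem_univ i₀
        rw [← h] at this
        simp [ht] at this
      refine ⟨t, ?_⟩
      ext z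
      rw [hi, hleaf₀, SimpleGraph.mem_neighborSet, R.adj_iff, Set.mem_singleton_iff]
      constructor
      · rintro (⟨h, -⟩ | ⟨h, hp⟩)
        · exact (h rfl).elim
        · by_contra hzt
          have h1 : R.le z t := (hle z t).2 fun j hj => by
            rw [ht, Finset.mem_compl, Finset.mem_singleton]
            rintro rfl
            exact hi₀ z h hj
          have h2 := ((R.le_iff.1 h1).resolve_left hzt).2
          rw [hp] at h2
          exact htr (R.root_le h2)
      · rintro rfl
        refine Or.inr ⟨htr, ?_⟩
        by_contra h
        have h1 := hsub t htr
        have h2 := hi₀ _ h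
        refine h1.2 fun j hj => ?_
        rw [ht, Finset.mem_compl, Finset.mem_singleton]
        rintro rfl
        exact h2 hj
    · refine ⟨R.p (leaf i), ?_⟩
      ext z
      rw [SimpleGraph.mem_neighborSet, R.adj_iff, Set.mem_singleton_iff]
      constructor
      · rintro (⟨-, h⟩ | ⟨h, hp⟩)
        · exact h.symm
        · have h1 := hsub z h
          rw [hp, hleaf i hi, Finset.ssubset_singleton_iff] at h1
          exact ((hL.nonempty z.1 z.2).ne_empty h1).elim
      · intro h
        exact Or.inl ⟨hleafr i hi, h.symm⟩
  let T : WTree n :=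
    { V := L
      fintypeV := Fintype.ofFinite _
      G := G
      isTree := R.isTree
      leaf := leaf
      leafInj := hinj
      leafSpec := fun v => by
        refine ⟨fun h => ?_, ?_⟩
        · by_contra h'
          have := hnode v h'
          omega
        · rintro ⟨i, rfl⟩
          exact hleaf1 i
      w := w
      wSupport := hw' }
  have hgen : ∀ r', r' = r → ∃ R' : Rooting G r',
      (∀ x y, R'.le x y ↔ R.le x y) ∧ R'.p = R.p := by
    rintro _ rfl
    exact ⟨R, fun _ _ => Iff.rfl, rfl⟩
  obtain ⟨R', hR', hRp⟩ := hgen (leaf i₀) hleaf₀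
  have hc : ∀ x : L, WTree.cluster (T := T) R' x = x.1 := by
    intro x
    ext i
    rw [WTree.mem_cluster]
    exact (hR' _ _).trans (hmem i x)
  refine ⟨T, R', ?_, ?_, ?_⟩
  · intro v hv
    change (G.neighborSet v).ncard = 2 at hv
    by_cases h : v ∈ Set.range leaf
    · obtain ⟨i, rfl⟩ := h
      have := hleaf1 i
      omega
    · have := hnode v h
      omega
  · intro C
    refine ⟨fun h => ⟨⟨C, h⟩, hc _⟩, ?_⟩
    rintro ⟨y, rfl⟩
    exact (congrArg (· ∈ L) (hc y)).mpr (Subtype.property (p := (· ∈ L)) y)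
  · intro y hy
    rw [hc, hRp]
    exact hw y fun h => hy (h.trans hleaf₀.symm)

end IsHierarchy

namespace WTree

variable {n : ℕ} {T : WTree n} {i₀ : Fin n} (R : Rooting T.G (T.leaf i₀))

theorem isNode_of_notMem_range (hT : T.Essential) {v : T.V} (hv : v ∉ Set.range T.leaf)
    {u : T.V} (huv : T.G.Adj v u) : T.IsNode v := by
  have h1 : T.deg v ≠ 1 := fun h => hv ((T.leafSpec v).1 h)
  have h2 : 0 < T.deg v := (Set.ncard_pos (Set.toFinite _)).2 ⟨u, huv⟩
  have h3 := hT v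
  unfold IsNode
  omega

theorem isTwigEdge_of_adj {i : Fin n} {v : T.V} (h : T.G.Adj (T.leaf i) v) (hv : T.IsNode v) :
    T.IsTwigEdge s(T.leaf i, v) := by
  refine ⟨i, v, hv, .cons h .nil, by simpa using h.ne, fun u hu hn => ?_, by simp⟩
  simp only [SimpleGraph.Walk.support_cons, SimpleGraph.Walk.support_nil, List.mem_cons,
    List.not_mem_nil, or_false] at hu
  rcases hu with rfl | rfl
  · have h1 := (T.leafSpec (T.leaf i)).2 ⟨i, rfl⟩
    unfold IsNode deg at hn
    omega
  · rfl

theorem internalNonzero_of_weight_ne_zero (hn : 3 ≤ n) (hT : T.Essential)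
    (h : ∀ y, y ≠ T.leaf i₀ → (∀ i, i ≠ i₀ → cluster R y ≠ {i}) → cluster R y ≠ {i₀}ᶜ →
      T.w s(y, R.p y) ≠ 0) : T.InternalNonzero := by
  intro e he htw
  obtain ⟨y, hy, rfl⟩ := R.exists_edge he
  have hcard : ∀ i, ({i} : Finset (Fin n)) ≠ {i₀}ᶜ := fun i h => by
    have := congrArg Finset.card h
    rw [Finset.card_compl] at this
    simp at this
    omega
  refine h y hy (fun i hi hc => htw ?_) fun hc => htw ?_
  · have hyi : y = T.leaf i := cluster_injective R hT (by rw [hc, cluster_leaf R (leaf_ne hi)])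
    have hadj := R.adj_parent hy
    subst hyi
    refine isTwigEdge_of_adj hadj (isNode_of_notMem_range hT ?_ hadj.symm)
    rintro ⟨j, hj⟩
    by_cases hj₀ : j = i₀
    · rw [hj₀] at hj
      exact hcard i (hc.symm.trans (cluster_eq_compl_of_parent R hy hj.symm))
    · exact parent_ne_leaf R (leaf_ne hj₀) hy hj.symm
  · obtain ⟨a, ha, hp⟩ := exists_root_child R
    obtain rfl : y = a := cluster_injective R hT (by rw [hc, cluster_eq_compl_of_parent R ha hp])
    have hadj := R.adj_parent hy
    rw [hp] at hadj ⊢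
    rw [Sym2.eq_swap]
    refine isTwigEdge_of_adj hadj.symm (isNode_of_notMem_range hT ?_ hadj)
    rintro ⟨j, rfl⟩
    have hj : j ≠ i₀ := fun h => hy (h ▸ rfl)
    exact hcard j (by rw [← hc, cluster_leaf R (leaf_ne hj)])

end WTree

section PendantSides

variable {n : ℕ} (i₀ : Fin n)

/-- The side, not containing `i₀`, of the pendant edge at the leaf `i`. -/
def pendantSide (i : Fin n) : Finset (Fin n) := if i = i₀ then {i₀}ᶜ else {i}

variable {i₀}

theorem pendantSide_splits_iff (i : Fin n) {I : Finset (Fin n)} (hI : 2 ≤ I.card) :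
    (pendantSide i₀ i).Splits I ↔ i ∈ I := by
  have h1 : ({i} : Finset (Fin n)).Splits I ↔ i ∈ I := by
    constructor
    · rintro ⟨⟨x, hx, hxi⟩, -⟩
      exact Finset.mem_singleton.1 hxi ▸ hx
    · intro hi
      obtain ⟨z, hz, hzi⟩ := Finset.exists_mem_ne (by omega : 1 < I.card) i
      exact ⟨⟨i, hi, by simp⟩, ⟨z, hz, by simpa using hzi⟩⟩
  unfold pendantSide
  split_ifs with h
  · rw [← h1, h]
    simp [Finset.Splits, and_comm]
  · exact h1

theorem card_pendantSide (i : Fin n) :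
    (pendantSide i₀ i).card = n - 1 ∨ (pendantSide i₀ i)ᶜ.card = n - 1 := by
  unfold pendantSide
  split_ifs
  · left; simp [Finset.card_compl]
  · right; simp [Finset.card_compl]

theorem pendantSide_injective (hn : 3 ≤ n) : Function.Injective (pendantSide i₀) := by
  have h1 : ∀ j, ({i₀}ᶜ : Finset (Fin n)) ≠ {j} := fun j h => by
    have := congrArg Finset.card h
    rw [Finset.card_compl] at this
    simp at this
    omega
  intro i j h
  unfold pendantSide at h
  split_ifs at h with hi hj hj
  · rw [hi, hj]
  · exact (h1 _ h).elim
  · exact (h1 _ h.symm).elim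
  · exact Finset.singleton_injective h

theorem notMem_pendantSide (i : Fin n) : i₀ ∉ pendantSide i₀ i := by
  unfold pendantSide
  split_ifs with h
  · simp
  · simpa using fun h' => h h'.symm

theorem pendantSide_nested {i x : Fin n} {C : Finset (Fin n)} (h : x ∈ pendantSide i₀ i)
    (hx : x ∈ C) (hC : i₀ ∈ C → C = Finset.univ) :
    pendantSide i₀ i ⊆ C ∨ C ⊆ pendantSide i₀ i := by
  unfold pendantSide at h ⊢
  split_ifs at h ⊢ with hi
  · by_cases h0 : i₀ ∈ C
    · rw [hC h0]
      exact Or.inl (Finset.subset_univ _)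
    · refine Or.inr fun y hy => ?_
      rw [Finset.mem_compl, Finset.mem_singleton]
      rintro rfl
      exact h0 hy
  · rw [Finset.mem_singleton] at h
    exact Or.inl (by simpa [← h] using hx)

theorem pendantSide_nonempty (hn : 2 ≤ n) (i : Fin n) : (pendantSide i₀ i).Nonempty := by
  rw [← Finset.card_pos]
  unfold pendantSide
  split_ifs
  · rw [Finset.card_compl]
    simp
    omega
  · simp

theorem splits_of_card_lt {k : ℕ} {C I : Finset (Fin n)} (hI : I.card = k) (h : C.card < k)
    (h' : Cᶜ.card < k) : C.Splits I := by
  constructor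
  · by_contra! hcon
    have := Finset.card_le_card (show I ⊆ Cᶜ from fun x hx => by simpa using hcon x hx)
    omega
  · by_contra! hcon
    have := Finset.card_le_card (show I ⊆ C from hcon)
    omega

/-- The total weight of the splits with no side of size at least `k`. -/
noncomputable def smallWeight (k : ℕ) (c : Finset (Fin n) → ℝ) : ℝ :=
  ∑ C, if C.card < k ∧ Cᶜ.card < k then c C else 0

open Classical in
/-- Move the weights of the splits with no side of size at least `k` to the pendant edges. -/
noncomputable def redistribute (i₀ : Fin n) (k : ℕ) (c : Finset (Fin n) → ℝ)
    (C : Finset (Fin n)) : ℝ :=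
  (if C.card < k ∧ Cᶜ.card < k then 0 else c C) +
    if C ∈ Finset.univ.image (pendantSide i₀) then smallWeight k c / k else 0

theorem splitSum_redistribute (hn : 3 ≤ n) {k : ℕ} (hk : 2 ≤ k) (c : Finset (Fin n) → ℝ)
    {I : Finset (Fin n)} (hI : I.card = k) :
    splitSum (redistribute i₀ k c) I = splitSum c I := by
  classical
  have h1 : ∀ C : Finset (Fin n), (if C.Splits I then redistribute i₀ k c C else 0) =
      ((if C.Splits I then c C else 0) - if C.card < k ∧ Cᶜ.card < k then c C else 0) +
      if C ∈ Finset.univ.image (pendantSide i₀) then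
        (if C.Splits I then smallWeight k c / k else 0) else 0 := by
    intro C
    unfold redistribute
    by_cases hC : C.card < k ∧ Cᶜ.card < k
    · simp [hC, splits_of_card_lt hI hC.1 hC.2]
    · by_cases hs : C.Splits I <;> simp [hC, hs]
  have h2 : ∑ C : Finset (Fin n), (if C ∈ Finset.univ.image (pendantSide i₀) then
      (if C.Splits I then smallWeight k c / k else 0) else 0) = smallWeight k c := by
    rw [Finset.sum_ite_mem, Finset.univ_inter,
      Finset.sum_image (pendantSide_injective hn).injOn]
    simp only [pendantSide_splits_iff _ (hI.symm ▸ hk : 2 ≤ I.card)]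
    rw [Finset.sum_ite_mem, Finset.univ_inter, Finset.sum_const, hI, nsmul_eq_mul]
    have : (k : ℝ) ≠ 0 := by
      have : k ≠ 0 := by omega
      exact_mod_cast this
    field_simp
  unfold splitSum
  rw [Finset.sum_congr rfl fun C _ => h1 C, Finset.sum_add_distrib, Finset.sum_sub_distrib, h2]
  simp [smallWeight]

end PendantSides

namespace WTree

variable {n : ℕ}

/-- Every weighted tree has the same `k`-weights as an internal-nonzero-weighted essential
pseudostar. -/
theorem exists_pseudostar {k : ℕ} (h3 : 3 ≤ k) (hk : k + 1 ≤ n) (T : WTree n) :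
    ∃ P : WTree n, P.InternalNonzero ∧ P.Essential ∧ P.IsPseudostar k ∧
      ∀ I : Finset (Fin n), I.card = k → P.D I = T.D I := by
  classical
  let i₀ : Fin n := ⟨0, by omega⟩
  obtain ⟨R⟩ := T.isTree.exists_rooting (T.leaf i₀)
  set c := clusterWeight R with hc
  set L : Set (Finset (Fin n)) := {C | C = Finset.univ ∨ (∃ i, pendantSide i₀ i = C) ∨
    ¬ (C.card < k ∧ Cᶜ.card < k) ∧ c C ≠ 0} with hLdef
  have hi₀ : ∀ C ∈ L, i₀ ∈ C → C = Finset.univ := by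
    rintro C (h | ⟨i, rfl⟩ | ⟨-, h⟩) hC
    · exact h
    · exact (notMem_pendantSide i hC).elim
    · exact (h (clusterWeight_eq_zero_of_mem R hC)).elim
  have hL : IsHierarchy i₀ L :=
    { univ_mem := Or.inl rfl
      compl_mem := Or.inr (Or.inl ⟨i₀, if_pos rfl⟩)
      singleton_mem := fun i hi => Or.inr (Or.inl ⟨i, if_neg hi⟩)
      nonempty := by
        rintro C (rfl | ⟨i, rfl⟩ | ⟨-, h⟩)
        · exact ⟨i₀, Finset.mem_univ _⟩
        · exact pendantSide_nonempty (by omega) i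
        · obtain ⟨y, hy, rfl⟩ := exists_of_clusterWeight_ne_zero R h
          exact cluster_nonempty R hy
      eq_univ := hi₀
      nested := by
        intro C hC C' hC' x hx hx'
        rcases id hC with rfl | ⟨i, rfl⟩ | ⟨-, h⟩
        · exact Or.inr (Finset.subset_univ _)
        · exact pendantSide_nested hx hx' (hi₀ C' hC')
        rcases id hC' with rfl | ⟨i, rfl⟩ | ⟨-, h'⟩
        · exact Or.inl (Finset.subset_univ _)
        · exact (pendantSide_nested hx' hx (hi₀ C hC)).symm
        obtain ⟨y, hy, rfl⟩ := exists_of_clusterWeight_ne_zero R h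
        obtain ⟨z, hz, rfl⟩ := exists_of_clusterWeight_ne_zero R h'
        exact (comparable_of_mem R hx hx').imp (cluster_mono R) (cluster_mono R) }
  obtain ⟨P, Q, hP, hPL, hPw⟩ := hL.exists_tree (by omega) (redistribute i₀ k c)
  have hweight : clusterWeight Q = redistribute i₀ k c := by
    funext C
    by_cases hC : i₀ ∈ C
    · have h1 : c C = 0 := clusterWeight_eq_zero_of_mem R hC
      have h2 : C ∉ Finset.univ.image (pendantSide i₀) := fun h => by
        obtain ⟨i, -, rfl⟩ := Finset.mem_image.1 h
        exact notMem_pendantSide i hC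
      rw [clusterWeight_eq_zero_of_mem Q hC, redistribute, if_neg h2, h1, ite_self, add_zero]
    by_cases hCL : C ∈ L
    · obtain ⟨y, rfl⟩ := (hPL C).1 hCL
      have hy : y ≠ P.leaf i₀ := by
        rintro rfl
        exact hC (by simp [cluster_root])
      rw [clusterWeight_cluster Q hP hy, hPw y hy]
    · have h1 : clusterWeight Q C = 0 := by
        by_contra h
        obtain ⟨y, -, hy⟩ := exists_of_clusterWeight_ne_zero Q h
        exact hCL ((hPL C).2 ⟨y, hy⟩)
      have h2 : C ∉ Finset.univ.image (pendantSide i₀) := fun h => by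
        obtain ⟨i, -, hi⟩ := Finset.mem_image.1 h
        exact hCL (Or.inr (Or.inl ⟨i, hi⟩))
      rw [h1, redistribute, if_neg h2, add_zero]
      split_ifs with h
      · rfl
      · by_contra h'
        exact hCL (Or.inr (Or.inr ⟨h, fun h'' => h' h''.symm⟩))
  have hcases : ∀ y, y ≠ P.leaf i₀ → (∃ i, pendantSide i₀ i = cluster Q y) ∨
      ¬ ((cluster Q y).card < k ∧ (cluster Q y)ᶜ.card < k) ∧ c (cluster Q y) ≠ 0 := by
    intro y hy
    refine ((hPL _).2 ⟨y, rfl⟩).resolve_left fun h => notMem_cluster Q hy ?_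
    rw [h]
    exact Finset.mem_univ _
  refine ⟨P, ?_, hP, ?_, ?_⟩
  · refine internalNonzero_of_weight_ne_zero Q (by omega) hP fun y hy h1 h2 => ?_
    have h3 : ¬ ∃ i, pendantSide i₀ i = cluster Q y := by
      rintro ⟨i, hi⟩
      unfold pendantSide at hi
      split_ifs at hi with h
      · exact h2 hi.symm
      · exact h1 i h hi.symm
    have h4 := (hcases y hy).resolve_left h3
    have h5 : cluster Q y ∉ Finset.univ.image (pendantSide i₀) := fun h => by
      obtain ⟨i, -, hi⟩ := Finset.mem_image.1 h
      exact h3 ⟨i, hi⟩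
    rw [hPw y hy, redistribute, if_neg h4.1, if_neg h5, add_zero]
    exact h4.2
  · rw [isPseudostar_iff Q]
    intro y hy
    rcases hcases y hy with ⟨i, hi⟩ | ⟨h, -⟩
    · have := card_pendantSide (i₀ := i₀) i
      rw [hi] at this
      omega
    · omega
  · intro I hI
    rw [D_eq_splitSum Q, D_eq_splitSum R, hweight]
    exact splitSum_redistribute (by omega) (by omega) c hI

end WTree

/-- if `3 ≤ k ≤ n-1` and the family `{D_I}` of real numbers indexed by the
`k`-subsets of `[n]` is l-treelike, then there is exactly one internal-nonzero-weighted
essential pseudostar of kind `(n,k)` with leaf set `[n]` realizing the family. -/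
theorem statement0 (n k : ℕ) (h3 : 3 ≤ k) (hk : k ≤ n - 1)
    (D₀ : Finset (Fin n) → ℝ)
    (hD : ∃ T : WTree n, T.Realizes k D₀) :
    ∃ P : WTree n,
      (P.InternalNonzero ∧ P.Essential ∧ P.IsPseudostar k ∧ P.Realizes k D₀) ∧
      ∀ P' : WTree n,
        (P'.InternalNonzero ∧ P'.Essential ∧ P'.IsPseudostar k ∧ P'.Realizes k D₀) →
        P'.Isom P := by
  obtain ⟨T, hT⟩ := hD
  obtain ⟨P, h1, h2, hP, h4⟩ := T.exists_pseudostar h3 (by omega)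
  have h5 : P.Realizes k D₀ := fun I hI => (h4 I hI).trans (hT I hI)
  refine ⟨P, ⟨h1, h2, hP, h5⟩, ?_⟩
  rintro P' ⟨h1', h2', hP', h5'⟩
  let i₀ : Fin n := ⟨0, by omega⟩
  obtain ⟨R⟩ := P.isTree.exists_rooting (P.leaf i₀)
  obtain ⟨R'⟩ := P'.isTree.exists_rooting (P'.leaf i₀)
  exact WTree.isom_of_clusterWeight_eq R' R h2' h1' h2 h1
    (WTree.clusterWeight_eq_of_D_eq R' h3 (by omega) R hP' hP
      fun I hI => (h5' I hI).trans (h5 I hI).symm)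
end

section
/- Let n, k ∈ ℕ with 3 ≤ k ≤ n−1 and let {D_I}, indexed by the k-subsets I of [n], be a p-l-treelike family of real numbers. Then the unique internal-nonzero-weighted essential pseudostar of kind (n,k) with leaf set [n] realizing the family {D_I} is positive-weighted. -/
/-! ### Phylogenetic diversity of a weighted system of splits -/

namespace SplitSystem

open Classical Finset

variable {ι E F : Type*}

/-- The split `e` separates two elements of `I`. -/
def Cut (s : E → ι → Bool) (e : E) (I : Finset ι) : Prop :=
  ∃ i ∈ I, ∃ j ∈ I, s e i ≠ s e j

/-- The total weight of the splits which separate two elements of `I`. -/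
noncomputable def diversity [Fintype E] (s : E → ι → Bool) (w : E → ℝ) (I : Finset ι) : ℝ :=
  ∑ e, if Cut s e I then w e else 0

/-- For any two splits of the system, some side of the first lies within a side of the second. -/
def Compatible (s : E → ι → Bool) : Prop :=
  ∀ e f, ∃ c, ∀ i j, s e i = c → s e j = c → s f i = s f j

/-- The split `e` has `a, b` on one side and `c, d` on the other. -/
def Sep (s : E → ι → Bool) (e : E) (a b c d : ι) : Prop :=
  s e a = s e b ∧ s e c = s e d ∧ s e a ≠ s e c

/-- The splits `e` and `f` of two systems agree. -/
def Same (s : E → ι → Bool) (t : F → ι → Bool) (e : E) (f : F) : Prop :=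
  ∀ i j, s e i = s e j ↔ t f i = t f j

/-- Both sides of the split `e` have at least two elements. -/
def Internal (s : E → ι → Bool) (e : E) : Prop :=
  ∀ i, ∃ j, j ≠ i ∧ s e j = s e i

lemma eq_of_ne_of_ne {x y z : Bool} (hx : x ≠ y) (hz : z ≠ y) : x = z := by
  revert x y z
  decide

lemma Compatible.not_sep {s : E → ι → Bool} (hs : Compatible s) {e f : E} {a b c d : ι}
    (he : Sep s e a b c d) : ¬ Sep s f a c b d := by
  obtain ⟨x, hx⟩ := hs e f
  rintro ⟨h1, h2, h3⟩
  obtain ⟨h4, h5, h6⟩ := he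
  by_cases h : s e a = x
  · exact h3 (hx a b h (h4 ▸ h))
  · have hc : s e c = x := eq_of_ne_of_ne h6.symm (Ne.symm h)
    exact h3 (h1.trans ((hx c d hc (h5 ▸ hc)).trans h2.symm))

lemma Compatible.exists_min [Fintype E] {s : E → ι → Bool} (hs : Compatible s) (a b : ι) {X : Finset ι}
    (hX : X.Nonempty) : ∃ y ∈ X, ∀ x ∈ X, ∀ f, s f a ≠ s f b → s f y = s f a → s f x = s f a := by
  let N : ι → Finset E := fun x => univ.filter fun f => s f a ≠ s f b ∧ s f x = s f a
  obtain ⟨y, hy, hmin⟩ := X.exists_min_image (fun x => (N x).card) hX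
  refine ⟨y, hy, fun x hx f hf hfy => ?_⟩
  by_contra hfx
  have hsub : N x ⊆ N y := by
    intro g hg
    simp only [N, mem_filter, mem_univ, true_and] at hg ⊢
    refine ⟨hg.1, ?_⟩
    by_contra hgy
    refine hs.not_sep (e := f) (f := g) (a := a) (b := y) (c := x) (d := b) ⟨hfy.symm, ?_, ?_⟩
      ⟨hg.2.symm, ?_, fun h => hgy h.symm⟩
    · exact eq_of_ne_of_ne hfx hf.symm
    · exact fun h => hfx h.symm
    · exact eq_of_ne_of_ne hgy hg.1.symm
  have heq := eq_of_subset_of_card_le hsub (hmin x hx)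
  have : f ∈ N x := by
    rw [heq]
    simpa [N] using ⟨hf, hfy⟩
  simp only [N, mem_filter] at this
  exact hfx this.2.2

lemma Compatible.exists_sep_imp_same [Fintype ι] [Fintype E] {s : E → ι → Bool} (hs : Compatible s) {t : F → ι → Bool}
    {e : F} (he : Internal t e) {a b : ι} (hab : t e a ≠ t e b) :
    ∃ a' b', a' ≠ a ∧ b' ≠ b ∧ Sep t e a a' b b' ∧ ∀ f, Sep s f a a' b b' → Same t s e f := by
  obtain ⟨a₁, ha₁, ha₁'⟩ := he a
  obtain ⟨b₁, hb₁, hb₁'⟩ := he b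
  obtain ⟨a', ha', hA⟩ := hs.exists_min a b (X := univ.filter fun x => x ≠ a ∧ t e x = t e a)
    ⟨a₁, by simp [ha₁, ha₁']⟩
  obtain ⟨b', hb', hB⟩ := hs.exists_min b a (X := univ.filter fun x => x ≠ b ∧ t e x = t e b)
    ⟨b₁, by simp [hb₁, hb₁']⟩
  simp only [mem_filter, mem_univ, true_and] at ha' hb' hA hB
  refine ⟨a', b', ha'.1, hb'.1, ⟨ha'.2.symm, hb'.2.symm, hab⟩, ?_⟩
  rintro f ⟨h1, h2, h3⟩
  have hA' : ∀ x, t e x = t e a → s f x = s f a := fun x hx => by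
    by_cases h : x = a
    · rw [h]
    · exact hA x ⟨h, hx⟩ f h3 h1.symm
  have hB' : ∀ x, t e x = t e b → s f x = s f b := fun x hx => by
    by_cases h : x = b
    · rw [h]
    · exact hB x ⟨h, hx⟩ f h3.symm h2.symm
  intro i j
  have hor : ∀ x, t e x ≠ t e a → t e x = t e b := fun x hx => eq_of_ne_of_ne hx hab.symm
  by_cases hi : t e i = t e a <;> by_cases hj : t e j = t e a
  · simp [hi, hj, hA' i hi, hA' j hj]
  · simp [hi, hor j hj, hA' i hi, hB' j (hor j hj), hab, h3]
  · simp [hj, hor i hi, hA' j hj, hB' i (hor i hi), hab.symm, h3.symm]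
  · simp [hor i hi, hor j hj, hB' i (hor i hi), hB' j (hor j hj)]

lemma diversity_quartet [Fintype E] (s : E → ι → Bool) (w : E → ℝ) (a a' b b' : ι) {R : Finset ι}
    (hR : R.Nonempty) :
    diversity s w (insert a (insert b R)) + diversity s w (insert a' (insert b' R))
      - diversity s w (insert a (insert a' R)) - diversity s w (insert b (insert b' R)) =
    ∑ e, if Cut s e R then 0 else
      if Sep s e a a' b b' then w e else if Sep s e a b a' b' then - w e else 0 := by
  unfold diversity
  rw [← sum_add_distrib, ← sum_sub_distrib, ← sum_sub_distrib]
  refine sum_congr rfl fun e _ => ?_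
  by_cases hc : Cut s e R
  · have hmono : ∀ x y, Cut s e (insert x (insert y R)) := by
      obtain ⟨i, hi, j, hj, hij⟩ := hc
      exact fun x y => ⟨i, by simp [hi], j, by simp [hj], hij⟩
    simp [hc, hmono]
  · obtain ⟨r, hr⟩ := hR
    have hcut : ∀ x y, Cut s e (insert x (insert y R)) ↔ ¬ (s e x = s e r ∧ s e y = s e r) := by
      intro x y
      have hR' : ∀ i ∈ R, s e i = s e r := fun i hi => by
        by_contra h
        exact hc ⟨i, hi, r, hr, h⟩
      constructor
      · rintro ⟨i, hi, j, hj, hij⟩ ⟨hx, hy⟩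
        simp only [mem_insert] at hi hj
        have h1 : ∀ i, i = x ∨ i = y ∨ i ∈ R → s e i = s e r := by
          rintro i (rfl | rfl | h)
          exacts [hx, hy, hR' i h]
        exact hij ((h1 i hi).trans (h1 j hj).symm)
      · intro h
        by_cases hx : s e x = s e r
        · exact ⟨y, by simp, r, by simp [hr], fun hy => h ⟨hx, hy⟩⟩
        · exact ⟨x, by simp, r, by simp [hr], hx⟩
    simp only [hcut, hc, if_false, Sep]
    rcases Bool.eq_false_or_eq_true (s e a) with h1 | h1 <;>
    rcases Bool.eq_false_or_eq_true (s e a') with h2 | h2 <;>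
    rcases Bool.eq_false_or_eq_true (s e b) with h3 | h3 <;>
    rcases Bool.eq_false_or_eq_true (s e b') with h4 | h4 <;>
    rcases Bool.eq_false_or_eq_true (s e r) with h5 | h5 <;>
    simp [h1, h2, h3, h4, h5]

/-- The split `e` separates `i` from the rest of `S`. -/
def Isolates (s : E → ι → Bool) (e : E) (S : Finset ι) (i : ι) : Prop :=
  ∀ x ∈ S, x ≠ i → s e x ≠ s e i

/-- The split `e` induces on `S` a split whose sides both have at least two elements. -/
def InternalOn (s : E → ι → Bool) (e : E) (S : Finset ι) : Prop :=
  Cut s e S ∧ ∀ i ∈ S, ∃ j ∈ S, j ≠ i ∧ s e j = s e i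

lemma sum_cut_erase (s : E → ι → Bool) (e : E) {k : ℕ} (hk : 3 ≤ k) {S : Finset ι}
    (hS : S.card = k + 1) {i : ι} (hi : i ∈ S) (w : ℝ) :
    (∑ m ∈ S, if Cut s e (S.erase m) then w else 0) - k * (if Cut s e (S.erase i) then w else 0) =
      k * (if Isolates s e S i then w else 0) + if InternalOn s e S then w else 0 := by
  by_cases hc : Cut s e S
  · by_cases hiso : ∃ m ∈ S, Isolates s e S m
    · obtain ⟨m, hm, hmS⟩ := hiso
      have hcut : ∀ x ∈ S, (Cut s e (S.erase x) ↔ x ≠ m) := by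
        intro x hx
        constructor
        · rintro ⟨p, hp, q, hq, hpq⟩ rfl
          rw [mem_erase] at hp hq
          exact hpq (eq_of_ne_of_ne (hmS p hp.2 hp.1) (hmS q hq.2 hq.1))
        · intro hxm
          obtain ⟨y, hy⟩ : ((S.erase x).erase m).Nonempty := by
            rw [← card_pos, card_erase_of_mem (by simp [hm, hxm.symm]), card_erase_of_mem hx]
            omega
          simp only [mem_erase] at hy
          exact ⟨y, by simp [hy], m, by simp [hm, hxm.symm], hmS y hy.2.2 hy.1⟩
      have hsum : (∑ m ∈ S, if Cut s e (S.erase m) then w else 0) = k * w := by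
        rw [sum_congr rfl fun x hx => if_congr (hcut x hx) rfl rfl, ← sum_filter, sum_const,
          filter_ne', card_erase_of_mem hm, hS]
        simp
      have h_internal : ¬ InternalOn s e S := by
        rintro ⟨-, h⟩
        obtain ⟨j, hj, hjm, h⟩ := h m hm
        exact hmS j hj hjm h
      have hisoi : Isolates s e S i ↔ i = m := by
        refine ⟨fun h => ?_, fun h => h ▸ hmS⟩
        by_contra him
        obtain ⟨y, hy⟩ : ((S.erase i).erase m).Nonempty := by
          rw [← card_pos, card_erase_of_mem (by simp [hm, Ne.symm him]), card_erase_of_mem hi]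
          omega
        simp only [mem_erase] at hy
        exact h y hy.2.2 hy.2.1 (eq_of_ne_of_ne (hmS y hy.2.2 hy.1) (hmS i hi him))
      rw [hsum, if_neg h_internal]
      simp only [hcut i hi, hisoi]
      by_cases h : i = m <;> simp [h]
    · push Not at hiso
      have hfull : ∀ m ∈ S, ∃ j ∈ S, j ≠ m ∧ s e j = s e m := by
        intro m hm
        have := hiso m hm
        unfold Isolates at this
        push Not at this
        exact this
      have hcut : ∀ x ∈ S, Cut s e (S.erase x) := by
        intro x hx
        obtain ⟨j, hj, hjx, hj'⟩ := hfull x hx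
        obtain ⟨p, hp, q, hq, hpq⟩ := hc
        by_cases hpx : s e p = s e x
        · exact ⟨q, by rw [mem_erase]; exact ⟨by rintro rfl; exact hpq hpx, hq⟩,
            j, by simp [hj, hjx], by rw [hj', ← hpx]; exact hpq.symm⟩
        · exact ⟨p, by rw [mem_erase]; exact ⟨by rintro rfl; exact hpx rfl, hp⟩,
            j, by simp [hj, hjx], by rw [hj']; exact hpx⟩
      rw [sum_congr rfl fun x hx => if_pos (hcut x hx), if_pos (hcut i hi), if_neg (hiso i hi),
        if_pos ⟨hc, hfull⟩, sum_const, hS]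
      simp
      ring
  · have hcut : ∀ x, ¬ Cut s e (S.erase x) := by
      rintro x ⟨p, hp, q, hq, hpq⟩
      exact hc ⟨p, mem_of_mem_erase hp, q, mem_of_mem_erase hq, hpq⟩
    have hiso : ¬ Isolates s e S i := by
      intro h
      obtain ⟨y, hy⟩ : (S.erase i).Nonempty := by
        rw [← card_pos, card_erase_of_mem hi]
        omega
      rw [mem_erase] at hy
      exact hc ⟨y, hy.2, i, hi, h y hy.2 hy.1⟩
    simp [hcut, hiso, InternalOn, hc]

lemma sum_diversity_erase [Fintype E] (s : E → ι → Bool) (w : E → ℝ) {k : ℕ} (hk : 3 ≤ k) {S : Finset ι}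
    (hS : S.card = k + 1) {i : ι} (hi : i ∈ S) :
    ∑ m ∈ S, diversity s w (S.erase m) - k * diversity s w (S.erase i) =
      k * (∑ e, if Isolates s e S i then w e else 0) +
        ∑ e, if InternalOn s e S then w e else 0 := by
  unfold diversity
  rw [sum_comm, mul_sum, mul_sum, ← sum_sub_distrib, ← sum_add_distrib]
  exact sum_congr rfl fun e _ => sum_cut_erase s e hk hS hi (w e)

/-- A split with both sides large enough has a quartet of elements, together with a `k`-subset
completion lying on one side. -/
lemma exists_completion [Fintype ι] {s : E → ι → Bool} {e : E} {k : ℕ} {b b' : ι}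
    (hk : k ≤ (univ.filter fun j => s e j = s e b).card) (hb : s e b' = s e b) (hbb : b' ≠ b) :
    ∃ R : Finset ι, R.card = k - 2 ∧ b ∉ R ∧ b' ∉ R ∧ ∀ r ∈ R, s e r = s e b := by
  have : k - 2 ≤ (((univ.filter fun j => s e j = s e b).erase b).erase b').card := by
    rw [card_erase_of_mem (by simp [hb, hbb]), card_erase_of_mem (by simp)]
    omega
  obtain ⟨R, hR, hcard⟩ := exists_subset_card_eq this
  refine ⟨R, hcard, fun h => ?_, fun h => ?_, fun r hr => ?_⟩
  · simpa using hR h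
  · simpa using hR h
  · have := hR hr
    simp only [mem_erase, mem_filter] at this
    exact this.2.2.2

section Comparison

variable {s : E → ι → Bool} {w : E → ℝ} {t : F → ι → Bool} {v : F → ℝ} {k : ℕ}

/-- The quartet functional of a `k`-subset family, evaluated on two systems realizing it. -/
lemma quartet_eq [Fintype E] [Fintype F] (hk : 3 ≤ k) (h : ∀ I : Finset ι, I.card = k → diversity s w I = diversity t v I)
    {e : E} (hs : Compatible s) {a a' b b' : ι} (hsep : Sep s e a a' b b') (haa : a' ≠ a)
    (hbb : b' ≠ b) {R : Finset ι} (hR : R.card = k - 2) (hbR : b ∉ R) (hbR' : b' ∉ R)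
    (hRb : ∀ r ∈ R, s e r = s e b) :
    (∑ f, if ¬ Cut s f R ∧ Sep s f a a' b b' then w f else 0) =
      ∑ f, if Cut t f R then 0 else
        if Sep t f a a' b b' then v f else if Sep t f a b a' b' then - v f else 0 := by
  have hne : R.Nonempty := by
    rw [← card_pos]
    omega
  obtain ⟨h1, h2, h3⟩ := id hsep
  have haR : a ∉ R := fun h => h3 (hRb a h)
  have haR' : a' ∉ R := fun h => h3 (h1.trans (hRb a' h))
  have hcard : ∀ x y : ι, x ≠ y → x ∉ R → y ∉ R → (insert x (insert y R)).card = k := by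
    intro x y hxy hx hy
    rw [card_insert_of_notMem (by simp [hxy, hx]), card_insert_of_notMem hy]
    omega
  have hab : a ≠ b := fun h => h3 (by rw [h])
  have hab' : a' ≠ b' := fun h => h3 (by rw [h1, h2, h])
  rw [← diversity_quartet t v a a' b b' hne, ← h _ (hcard a b hab haR hbR),
    ← h _ (hcard a' b' hab' haR' hbR'), ← h _ (hcard a a' haa.symm haR haR'),
    ← h _ (hcard b b' hbb.symm hbR hbR'), diversity_quartet s w a a' b b' hne]
  refine sum_congr rfl fun f _ => ?_
  have := hs.not_sep (f := f) hsep
  simp only [this, if_false]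
  by_cases hc : Cut s f R <;> simp [hc]

/-- A split of large side is uniquely oriented so that the large side contains `b`. -/
lemma exists_large_side [Fintype ι] {e : E} (hsplit : ∃ i j, s e i ≠ s e j)
    (hbig : ∃ i, k ≤ (univ.filter fun j => s e j = s e i).card) :
    ∃ a b, s e a ≠ s e b ∧ k ≤ (univ.filter fun j => s e j = s e b).card := by
  obtain ⟨b, hb⟩ := hbig
  obtain ⟨i, j, hij⟩ := hsplit
  by_cases hib : s e i = s e b
  · exact ⟨j, b, fun h => hij (hib.trans h.symm), hb⟩
  · exact ⟨i, b, hib, hb⟩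

lemma weight_pos_of_internal [Fintype ι] [Fintype E] [Fintype F] (hk : 3 ≤ k)
    (h : ∀ I : Finset ι, I.card = k → diversity s w I = diversity t v I)
    (hs : Compatible s) (ht : Compatible t) (hv : ∀ f, 0 < v f)
    (hinj : ∀ e f, Same s s e f → e = f) (hsplit : ∀ e, ∃ i j, s e i ≠ s e j)
    (hbig : ∀ e, ∃ i, k ≤ (univ.filter fun j => s e j = s e i).card)
    {e : E} (he : Internal s e) (hw : w e ≠ 0) : 0 < w e := by
  obtain ⟨a, b, hab, hcard⟩ := exists_large_side (hsplit e) (hbig e)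
  obtain ⟨a', b', haa, hbb, hsep, huniq⟩ := hs.exists_sep_imp_same he hab
  obtain ⟨h1, h2, h3⟩ := id hsep
  obtain ⟨R, hR, hbR, hbR', hRb⟩ := exists_completion hcard h2.symm hbb
  have hRe : ¬ Cut s e R := by
    rintro ⟨i, hi, j, hj, hij⟩
    exact hij ((hRb i hi).trans (hRb j hj).symm)
  have hiff : ∀ f, ¬ Cut s f R ∧ Sep s f a a' b b' ↔ f = e :=
    fun f => ⟨fun hf => (hinj e f (huniq f hf.2)).symm, fun hf => hf ▸ ⟨hRe, hsep⟩⟩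
  have hswap : ∀ f, ¬ Cut s f R ∧ Sep s f a a' b' b ↔ f = e := fun f => by
    rw [← hiff f]
    unfold Sep
    grind
  have hq := quartet_eq hk h hs hsep haa hbb hR hbR hbR' hRb
  have hq' := quartet_eq hk h hs (e := e) (a := a) (a' := a') (b := b') (b' := b)
    ⟨h1, h2.symm, by rwa [← h2]⟩ haa hbb.symm hR hbR' hbR (fun r hr => (hRb r hr).trans h2)
  simp only [hiff, sum_ite_eq', mem_univ, if_true] at hq
  simp only [hswap, sum_ite_eq', mem_univ, if_true] at hq'
  by_contra hneg
  have hneg : w e < 0 := lt_of_le_of_ne (not_lt.1 hneg) hw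
  have key : ∀ c d, w e = (∑ f, if Cut t f R then 0 else
      if Sep t f a a' c d then v f else if Sep t f a c a' d then - v f else 0) →
      ∃ f, Sep t f a c a' d := by
    intro c d hcd
    by_contra! hno
    refine hneg.not_ge (hcd ▸ sum_nonneg fun f _ => ?_)
    have := (hv f).le
    simp only [hno f, if_false]
    split_ifs <;> simp [this]
  obtain ⟨f, hf⟩ := key b b' hq
  obtain ⟨g, hg⟩ := key b' b hq'
  refine ht.not_sep (e := f) (f := g) (a := a) (b := b) (c := b') (d := a') ?_ ?_
  · obtain ⟨h1, h2, h3⟩ := hf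
    exact ⟨h1, h2.symm, by rwa [← h2]⟩
  · obtain ⟨h1, h2, h3⟩ := hg
    exact ⟨h1, h2.symm, by rwa [← h2]⟩

lemma weight_le_of_internal [Fintype ι] [Fintype E] [Fintype F] (hk : 3 ≤ k)
    (h : ∀ I : Finset ι, I.card = k → diversity s w I = diversity t v I)
    (hs : Compatible s) (ht : Compatible t) (hv : ∀ f, 0 < v f)
    (hsplit : ∀ e, ∃ i j, s e i ≠ s e j)
    (hbig : ∀ e, ∃ i, k ≤ (univ.filter fun j => s e j = s e i).card)
    (hpos : ∀ e, Internal s e → 0 < w e) {e : E} (he : Internal s e) :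
    w e ≤ ∑ f ∈ univ.filter (Same s t e), v f := by
  obtain ⟨a, b, hab, hcard⟩ := exists_large_side (hsplit e) (hbig e)
  obtain ⟨a', b', haa, hbb, hsep, huniq⟩ := ht.exists_sep_imp_same he hab
  obtain ⟨h1, h2, h3⟩ := id hsep
  obtain ⟨R, hR, hbR, hbR', hRb⟩ := exists_completion hcard h2.symm hbb
  have hRe : ¬ Cut s e R := by
    rintro ⟨i, hi, j, hj, hij⟩
    exact hij ((hRb i hi).trans (hRb j hj).symm)
  calc w e = if ¬ Cut s e R ∧ Sep s e a a' b b' then w e else 0 := by rw [if_pos ⟨hRe, hsep⟩]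
    _ ≤ ∑ f, if ¬ Cut s f R ∧ Sep s f a a' b b' then w f else 0 := by
      refine single_le_sum (f := fun f => if ¬ Cut s f R ∧ Sep s f a a' b b' then w f else 0)
        (fun f _ => ?_) (mem_univ e)
      split_ifs with hf
      · refine (hpos f fun i => ?_).le
        obtain ⟨-, g1, g2, g3⟩ := hf
        by_cases hi : s f i = s f a
        · by_cases hia : i = a
          · exact ⟨a', hia ▸ haa, by rw [hi, g1]⟩
          · exact ⟨a, Ne.symm hia, hi.symm⟩
        · have hi : s f i = s f b := eq_of_ne_of_ne hi g3.symm
          by_cases hib : i = b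
          · exact ⟨b', hib ▸ hbb, by rw [hi, g2]⟩
          · exact ⟨b, Ne.symm hib, hi.symm⟩
      · exact le_rfl
    _ = _ := quartet_eq hk h hs hsep haa hbb hR hbR hbR' hRb
    _ ≤ ∑ f ∈ univ.filter (Same s t e), v f := by
      rw [sum_filter]
      refine sum_le_sum fun f _ => ?_
      have := (hv f).le
      have := huniq f
      split_ifs <;> first | linarith | tauto

/-- A positive-weighted compatible system of splits forces any other compatible system of distinct
splits with the same `k`-weights to be positive-weighted, provided that each of its splits has a
side with at least `k` elements and its internal weights do not vanish. -/
theorem weight_pos [Fintype ι] [Fintype E] [Fintype F] (hk : 3 ≤ k) (hcard : k + 1 ≤ Fintype.card ι)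
    (h : ∀ I : Finset ι, I.card = k → diversity s w I = diversity t v I)
    (hs : Compatible s) (ht : Compatible t) (hv : ∀ f, 0 < v f)
    (hleaf : ∀ i, ∃ f, ∀ j, j ≠ i → t f j ≠ t f i)
    (hinj : ∀ e f, Same s s e f → e = f) (hsplit : ∀ e, ∃ i j, s e i ≠ s e j)
    (hbig : ∀ e, ∃ i, k ≤ (univ.filter fun j => s e j = s e i).card)
    (hw : ∀ e, Internal s e → w e ≠ 0) (e : E) : 0 < w e := by
  have hpos : ∀ e, Internal s e → 0 < w e := fun e he =>
    weight_pos_of_internal hk h hs ht hv hinj hsplit hbig he (hw e he)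
  by_cases he : Internal s e
  · exact hpos e he
  unfold Internal at he
  push Not at he
  obtain ⟨i, hi⟩ := he
  obtain ⟨j, hj⟩ : ((univ : Finset ι).erase i).Nonempty := by
    rw [← card_pos, card_erase_of_mem (mem_univ _), card_univ]
    omega
  have hji : j ≠ i := (mem_erase.1 hj).1
  have hX : ((univ.erase i).erase j).Nonempty := by
    rw [← card_pos, card_erase_of_mem hj, card_erase_of_mem (mem_univ _), card_univ]
    omega
  obtain ⟨l, hl, hmin⟩ := hs.exists_min j i hX
  have hl' : l ≠ j ∧ l ≠ i := by simpa using hl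
  obtain ⟨S, hsub, hS⟩ : ∃ S : Finset ι, {i, j, l} ⊆ S ∧ S.card = k + 1 :=
    exists_superset_card_eq (card_le_three.trans (by omega)) hcard
  have hiS : i ∈ S := hsub (by simp)
  have hjS : j ∈ S := hsub (by simp)
  have hlS : l ∈ S := hsub (by simp)
  have hiso : ∀ f, Isolates s f S i ↔ f = e := by
    intro f
    refine ⟨fun hf => (hinj e f ?_).symm, fun hf => hf ▸ fun x _ hx => hi x hx⟩
    have hfj := hf j hjS hji
    have hfl := hf l hlS hl'.2
    have hall : ∀ x, x ≠ i → s f x = s f j := by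
      intro x hx
      by_cases hxj : x = j
      · rw [hxj]
      · exact hmin x (by simp [hx, hxj]) f hfj (eq_of_ne_of_ne hfl hfj)
    have hall' : ∀ x, x ≠ i → s e x = s e j := fun x hx => eq_of_ne_of_ne (hi x hx) (hi j hji)
    have hij := hi j hji
    intro x y
    by_cases hx : x = i <;> by_cases hy : y = i
    · simp [hx, hy]
    · simp [hx, hall y hy, hall' y hy, hfj.symm, hij.symm]
    · simp [hy, hall x hx, hall' x hx, hfj, hij]
    · simp [hall x hx, hall' x hx, hall y hy, hall' y hy]
  have hF : ∑ m ∈ S, diversity s w (S.erase m) - k * diversity s w (S.erase i) =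
      ∑ m ∈ S, diversity t v (S.erase m) - k * diversity t v (S.erase i) := by
    have hE : ∀ m ∈ S, diversity s w (S.erase m) = diversity t v (S.erase m) := fun m hm =>
      h _ (by rw [card_erase_of_mem hm, hS]; rfl)
    rw [sum_congr rfl hE, hE i hiS]
  rw [sum_diversity_erase s w hk hS hiS, sum_diversity_erase t v hk hS hiS] at hF
  simp only [hiso, sum_ite_eq', mem_univ, if_true] at hF
  have hT : 0 < ∑ f, if Isolates t f S i then v f else 0 := by
    obtain ⟨f, hf⟩ := hleaf i
    refine sum_pos' (fun f _ => ?_) ⟨f, mem_univ f, ?_⟩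
    · have := (hv f).le
      split_ifs <;> simp [this]
    · rw [if_pos (show Isolates t f S i from fun x _ hx => hf x hx)]
      exact hv f
  have h_internal : (∑ f, if InternalOn s f S then w f else 0) ≤
      ∑ f, if InternalOn t f S then v f else 0 := by
    rw [← sum_filter, ← sum_filter]
    calc ∑ f ∈ univ.filter (fun f => InternalOn s f S), w f
        ≤ ∑ f ∈ univ.filter (fun f => InternalOn s f S), ∑ g ∈ univ.filter (Same s t f), v g := by
          refine sum_le_sum fun f hf => ?_
          refine weight_le_of_internal hk h hs ht hv hsplit hbig hpos fun x => ?_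
          obtain ⟨⟨p, hp, q, hq, hpq⟩, hfull⟩ := (mem_filter.1 hf).2
          have key : ∀ p ∈ S, s f p = s f x → ∃ y, y ≠ x ∧ s f y = s f x := by
            intro p hp hpx
            by_cases hpx' : p = x
            · subst hpx'
              obtain ⟨y, -, hy⟩ := hfull p hp
              exact ⟨y, hy⟩
            · exact ⟨p, hpx', hpx⟩
          by_cases hpx : s f p = s f x
          · exact key p hp hpx
          · exact key q hq (eq_of_ne_of_ne hpq.symm (Ne.symm hpx))
      _ = ∑ g ∈ (univ.filter (fun f => InternalOn s f S)).biUnion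
            (fun f => univ.filter (Same s t f)), v g := by
          rw [sum_biUnion]
          intro f _ f' _ hff
          refine disjoint_left.2 fun g hg hg' => hff (hinj f f' ?_)
          simp only [mem_filter, mem_univ, true_and] at hg hg'
          exact fun x y => (hg x y).trans (hg' x y).symm
      _ ≤ ∑ g ∈ univ.filter (fun g => InternalOn t g S), v g := by
          refine sum_le_sum_of_subset_of_nonneg (fun g hg => ?_) fun g _ _ => (hv g).le
          simp only [mem_biUnion, mem_filter, mem_univ, true_and] at hg ⊢
          obtain ⟨f, ⟨⟨p, hp, q, hq, hpq⟩, hfull⟩, hfg⟩ := hg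
          refine ⟨⟨p, hp, q, hq, fun h => hpq ((hfg p q).2 h)⟩, fun x hx => ?_⟩
          obtain ⟨y, hy, hyx, hyx'⟩ := hfull x hx
          exact ⟨y, hy, hyx, (hfg y x).1 hyx'⟩
  have hk0 : (0 : ℝ) < k := by exact_mod_cast (by omega : 0 < k)
  have := mul_pos hk0 hT
  exact pos_of_mul_pos_right (by linarith : 0 < (k : ℝ) * w e) hk0.le

end Comparison

end SplitSystem

/-! ### Splits of the vertices of a tree -/

namespace SimpleGraph

variable {V : Type*} {G : SimpleGraph V}

/-- The vertices `x` and `y` remain connected after removing the edge `e`. -/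
abbrev SameSide (G : SimpleGraph V) (e : Sym2 V) (x y : V) : Prop :=
  (G.deleteEdges {e}).Reachable x y

lemma Adj.sameSide {x y : V} (h : G.Adj x y) {e : Sym2 V} (he : s(x, y) ≠ e) :
    G.SameSide e x y :=
  Adj.reachable (by simpa [deleteEdges_adj] using ⟨h, he⟩)

lemma IsAcyclic.not_sameSide (hG : G.IsAcyclic) {x y : V} (h : G.Adj x y) :
    ¬ G.SameSide s(x, y) x y :=
  isAcyclic_iff_forall_adj_isBridge.1 hG h

lemma Walk.sameSide_or {x u : V} (p : G.Walk x u) (v : V) :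
    G.SameSide s(u, v) u x ∨ G.SameSide s(u, v) v x := by
  induction p with
  | nil => exact .inl .rfl
  | @cons x y u h p ih =>
    by_cases he : s(x, y) = s(u, v)
    · have hx : x ∈ s(u, v) := he ▸ Sym2.mem_mk_left x y
      rcases Sym2.mem_iff.1 hx with rfl | rfl
      · exact .inl .rfl
      · exact .inr .rfl
    · have := (h.sameSide he).symm
      exact ih.imp (·.trans this) (·.trans this)

/-- Removing an edge does not disconnect a side of another edge which misses one of its ends. -/
lemma SameSide.of_mem {f g : Sym2 V} {x y u : V} (h : G.SameSide f x y)
    (hu : ¬ G.SameSide f x u) (hg : u ∈ g) : G.SameSide g x y := by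
  obtain ⟨p⟩ := h
  induction p with
  | nil => exact .rfl
  | @cons x y z h p ih =>
    have hxy : G.SameSide f x y := h.reachable
    refine Reachable.trans (Adj.sameSide (deleteEdges_adj.1 h).1 ?_) (ih fun h' => hu (hxy.trans h'))
    rintro rfl
    rcases Sym2.mem_iff.1 hg with rfl | rfl
    · exact hu .rfl
    · exact hu hxy

lemma IsAcyclic.sameSide_of_branch (hG : G.IsAcyclic) {u v z x : V} (hz : G.Adj u z) (hzv : z ≠ v)
    (h : G.SameSide s(z, u) z x) : G.SameSide s(u, v) u x := by
  refine (hz.sameSide fun h' => hzv ?_).trans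
    (h.of_mem (hG.not_sameSide hz.symm) (Sym2.mem_mk_left u v))
  exact Sym2.congr_right.1 h'

lemma SameSide.eq_of_neighborSet {x y z : V} (hx : G.neighborSet x = {y})
    (h : G.SameSide s(x, y) x z) : z = x := by
  obtain ⟨p⟩ := h
  cases p with
  | nil => rfl
  | @cons _ t _ h p =>
    obtain ⟨h1, h2⟩ := deleteEdges_adj.1 h
    have : t ∈ G.neighborSet x := h1
    rw [hx, Set.mem_singleton_iff] at this
    exact absurd (by rw [this]; rfl) h2

end SimpleGraph

namespace WTree

open SimpleGraph

variable {n : ℕ}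

lemma mem_pathEdges_iff_s1 (T : WTree n) {e : Sym2 T.V} {x y : T.V} :
    e ∈ T.pathEdges x y ↔ ¬ T.G.SameSide e x y := by
  classical
  constructor
  · rintro ⟨p, hp, he⟩ h
    obtain ⟨q, hq⟩ := h.exists_isPath
    have hq' : (q.mapLe (deleteEdges_le _)).IsPath := hq.mapLe _
    rw [(T.isTree.existsUnique_path x y).unique hp hq', Walk.edges_mapLe_eq_edges] at he
    have := q.edges_subset_edgeSet he
    simp [edgeSet_deleteEdges] at this
  · intro h
    obtain ⟨p, hp⟩ := (T.isTree.existsUnique_path x y).exists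
    refine ⟨p, hp, ?_⟩
    by_contra he
    exact h (p.toDeleteEdge e he).reachable

lemma mem_edgeSet_of_mem_pathEdges (T : WTree n) {e : Sym2 T.V} {x y : T.V}
    (h : e ∈ T.pathEdges x y) : e ∈ T.G.edgeSet := by
  obtain ⟨p, -, he⟩ := h
  exact p.edges_subset_edgeSet he

noncomputable instance (T : WTree n) : Fintype T.G.edgeSet :=
  haveI := T.fintypeV
  Fintype.ofFinite _

open Classical in
/-- The side of the edge `e` on which the vertex `x` lies. -/
noncomputable def vertexSide (T : WTree n) (e : T.G.edgeSet) (x : T.V) : Bool :=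
  decide (T.G.SameSide e (Quot.out e.1).1 x)

/-- The split of the leaves induced by an edge. -/
noncomputable def split (T : WTree n) (e : T.G.edgeSet) (i : Fin n) : Bool :=
  T.vertexSide e (T.leaf i)

lemma vertexSide_eq_iff (T : WTree n) {e : T.G.edgeSet} {x y : T.V} :
    T.vertexSide e x = T.vertexSide e y ↔ T.G.SameSide e x y := by
  have hor : ∀ x, T.G.SameSide e (Quot.out e.1).1 x ∨ T.G.SameSide e (Quot.out e.1).2 x := by
    intro x
    obtain ⟨p⟩ := T.isTree.connected.preconnected x (Quot.out e.1).1
    have := p.sameSide_or (Quot.out e.1).2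
    rwa [show s((Quot.out e.1).1, (Quot.out e.1).2) = e.1 from Quot.out_eq e.1] at this
  simp only [vertexSide, decide_eq_decide]
  refine ⟨fun h => ?_, fun h => ⟨fun h' => h'.trans h, fun h' => h'.trans h.symm⟩⟩
  by_cases hx : T.G.SameSide e (Quot.out e.1).1 x
  · exact hx.symm.trans (h.1 hx)
  · exact ((hor x).resolve_left hx).symm.trans ((hor y).resolve_left (fun hy => hx (h.2 hy)))

lemma split_eq_iff (T : WTree n) {e : T.G.edgeSet} {i j : Fin n} :
    T.split e i = T.split e j ↔ T.G.SameSide e (T.leaf i) (T.leaf j) :=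
  T.vertexSide_eq_iff

lemma D_eq_diversity (T : WTree n) (I : Finset (Fin n)) :
    T.D I = SplitSystem.diversity T.split (fun e => T.w e) I := by
  classical
  unfold D SplitSystem.diversity
  rw [← finsum_eq_sum_of_fintype,
    finsum_congr (g := fun e : T.G.edgeSet => if e.1 ∈ T.subtreeEdges ↑I then T.w e else 0),
    finsum_set_coe_eq_finsum_mem (T.G.edgeSet)
      (f := fun e => if e ∈ T.subtreeEdges ↑I then T.w e else 0)]
  · refine finsum_congr fun e => ?_
    by_cases he : e ∈ T.G.edgeSet
    · by_cases he' : e ∈ T.subtreeEdges ↑I <;> simp [he, he']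
    · have : e ∉ T.subtreeEdges ↑I := by
        rintro ⟨i, -, j, -, h⟩
        exact he (T.mem_edgeSet_of_mem_pathEdges h)
      simp [he, this]
  · intro e
    refine if_congr ?_ rfl rfl
    simp only [SplitSystem.Cut, subtreeEdges, mem_pathEdges_iff_s1, ne_eq, split_eq_iff]
    rfl

lemma compatible_split (T : WTree n) : SplitSystem.Compatible T.split := by
  intro e f
  refine ⟨!(T.vertexSide e (Quot.out f.1).1), fun i j hi hj => ?_⟩
  rw [split_eq_iff]
  refine SameSide.of_mem (f := e.1) (T.split_eq_iff.1 (hi.trans hj.symm)) (fun h => ?_)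
    (Sym2.out_fst_mem f.1)
  rw [← vertexSide_eq_iff] at h
  simp [split, h] at hi

lemma exists_leaf_sameSide (T : WTree n) {u v : T.V} (h : T.G.Adj u v) :
    ∃ i, T.G.SameSide s(u, v) u (T.leaf i) := by
  have := T.fintypeV
  induction hN : {x | T.G.SameSide s(u, v) u x}.ncard using Nat.strong_induction_on
    generalizing u v with
  | _ N ih =>
    by_cases hz : ∃ z, T.G.Adj u z ∧ z ≠ v
    · obtain ⟨z, hz, hzv⟩ := hz
      obtain ⟨i, hi⟩ := ih _ (by
        rw [← hN]
        refine Set.ncard_lt_ncard ⟨fun x hx => T.isTree.isAcyclic.sameSide_of_branch hz hzv hx, ?_⟩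
        exact fun hsub => T.isTree.isAcyclic.not_sameSide hz.symm (hsub (Reachable.rfl))) hz.symm rfl
      exact ⟨i, T.isTree.isAcyclic.sameSide_of_branch hz hzv hi⟩
    · push Not at hz
      have : T.G.neighborSet u = {v} := by
        ext z
        exact ⟨hz z, by rintro rfl; exact h⟩
      obtain ⟨i, hi⟩ := (T.leafSpec u).1 (by rw [this, Set.ncard_singleton])
      exact ⟨i, hi ▸ Reachable.rfl⟩

lemma exists_split_ne (T : WTree n) (e : T.G.edgeSet) : ∃ i j, T.split e i ≠ T.split e j := by
  obtain ⟨e, he⟩ := e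
  induction e with
  | _ u v =>
    obtain ⟨i, hi⟩ := T.exists_leaf_sameSide he
    obtain ⟨j, hj⟩ := T.exists_leaf_sameSide (Adj.symm he)
    rw [Sym2.eq_swap] at hj
    refine ⟨i, j, fun h => T.isTree.isAcyclic.not_sameSide he ?_⟩
    exact (hi.trans (T.split_eq_iff.1 h)).trans hj.symm

lemma exists_split_isolating (T : WTree n) (i : Fin n) :
    ∃ e, ∀ j, j ≠ i → T.split e j ≠ T.split e i := by
  obtain ⟨y, hy⟩ := Set.ncard_eq_one.1 ((T.leafSpec (T.leaf i)).2 ⟨i, rfl⟩)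
  have hadj : T.G.Adj (T.leaf i) y := by
    have : y ∈ T.G.neighborSet (T.leaf i) := by rw [hy]; rfl
    exact this
  refine ⟨⟨s(T.leaf i, y), hadj⟩, fun j hji h => hji ?_⟩
  exact T.leafInj (SameSide.eq_of_neighborSet hy (T.split_eq_iff.1 h.symm))

lemma Essential.exists_neighborSet_of_isTwigEdge {T : WTree n} (hT : T.Essential) {e : Sym2 T.V}
    (he : T.IsTwigEdge e) : ∃ i y, T.G.neighborSet (T.leaf i) = {y} ∧ e = s(T.leaf i, y) := by
  have := T.fintypeV
  obtain ⟨i, v, hv, p, hp, hnode, hep⟩ := he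
  obtain ⟨y, hy⟩ := Set.ncard_eq_one.1 ((T.leafSpec (T.leaf i)).2 ⟨i, rfl⟩)
  refine ⟨i, y, hy, ?_⟩
  generalize T.leaf i = x at *
  cases p with
  | nil => simp at hep
  | @cons _ t _ h q =>
    have ht : t = y := by
      have : t ∈ T.G.neighborSet x := h
      rwa [hy] at this
    subst ht
    cases q with
    | nil => simpa using hep
    | @cons _ z _ h' r =>
      rw [Walk.isPath_def] at hp
      simp only [Walk.support_cons, List.nodup_cons, List.mem_cons, not_or] at hp
      have hzx : z ≠ x := fun h => hp.1.2 (h ▸ r.start_mem_support)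
      have hdeg : 2 ≤ T.deg t := by
        rw [← Set.ncard_pair hzx.symm]
        refine Set.ncard_le_ncard ?_
        rintro a (rfl | rfl)
        exacts [h.symm, h']
      have htv := hnode t (by simp) (lt_of_le_of_ne hdeg (hT t).symm)
      exact absurd r.end_mem_support (htv ▸ hp.2.1)

lemma Essential.not_isTwigEdge {T : WTree n} (hT : T.Essential) {e : T.G.edgeSet}
    (he : SplitSystem.Internal T.split e) : ¬ T.IsTwigEdge e := by
  intro h
  obtain ⟨i, y, hy, hey⟩ := hT.exists_neighborSet_of_isTwigEdge h
  obtain ⟨j, hji, hj⟩ := he i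
  have := T.split_eq_iff.1 hj.symm
  rw [hey] at this
  exact hji (T.leafInj (this.eq_of_neighborSet hy))

/-- In an essential tree an edge whose leaf split is that of an edge contained in its side
would force a vertex of degree two. -/
lemma Essential.false_of_same {T : WTree n} (hT : T.Essential) {u v u' v' : T.V}
    (he : T.G.Adj u v) (hf : T.G.Adj u' v') (hu : T.G.SameSide s(u, v) u u')
    (hu' : ¬ T.G.SameSide s(u', v') u' u)
    (hsame : ∀ i j, T.G.SameSide s(u, v) (T.leaf i) (T.leaf j) ↔
      T.G.SameSide s(u', v') (T.leaf i) (T.leaf j)) : False := by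
  have := T.fintypeV
  have hG := T.isTree.isAcyclic
  obtain ⟨l₀, hl₀⟩ := T.exists_leaf_sameSide hf
  have hl₀' : T.G.SameSide s(u, v) u (T.leaf l₀) :=
    hu.trans (hl₀.of_mem hu' (Sym2.mem_mk_left u v))
  have hside : ∀ i, T.G.SameSide s(u, v) u (T.leaf i) →
      T.G.SameSide s(u', v') u' (T.leaf i) := fun i hi =>
    hl₀.trans ((hsame l₀ i).1 (hl₀'.symm.trans hi))
  have hdeg1 : T.deg u ≠ 1 := by
    intro h
    obtain ⟨i, hi⟩ := (T.leafSpec u).1 h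
    exact hu' (hi ▸ hside i (hi ▸ Reachable.rfl))
  have hv : v ∈ T.G.neighborSet u := he
  have hdeg0 : 0 < T.deg u := (Set.ncard_pos (Set.toFinite _)).2 ⟨v, hv⟩
  have hcard : 1 < (T.G.neighborSet u \ {v}).ncard := by
    have h1 := Set.ncard_sdiff_singleton_add_one hv (Set.toFinite _)
    have h2 := hT u
    unfold deg at *
    omega
  obtain ⟨z₁, ⟨hz₁, hz₁v⟩, z₂, ⟨hz₂, hz₂v⟩, hz⟩ := (Set.one_lt_ncard (Set.toFinite _)).1 hcard
  obtain ⟨l₁, hl₁⟩ := T.exists_leaf_sameSide (Adj.symm hz₁)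
  obtain ⟨l₂, hl₂⟩ := T.exists_leaf_sameSide (Adj.symm hz₂)
  have h₁ := hside l₁ (hG.sameSide_of_branch hz₁ hz₁v hl₁)
  have h₂ := hside l₂ (hG.sameSide_of_branch hz₂ hz₂v hl₂)
  have h₁₂ : T.G.SameSide s(u, z₁) (T.leaf l₁) (T.leaf l₂) :=
    SameSide.of_mem (h₁.symm.trans h₂) (fun h => hu' (h₁.trans h)) (Sym2.mem_mk_left u z₁)
  have hu₂ : T.G.SameSide s(u, z₁) u (T.leaf l₂) := hG.sameSide_of_branch hz₂ hz.symm hl₂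
  rw [Sym2.eq_swap] at hl₁
  exact hG.not_sameSide hz₁ (hu₂.trans (h₁₂.symm.trans hl₁.symm))

lemma Essential.split_injective {T : WTree n} (hT : T.Essential) {e f : T.G.edgeSet}
    (h : SplitSystem.Same T.split T.split e f) : e = f := by
  by_contra hne
  have key : ∀ (e : T.G.edgeSet) (z : T.V), ∃ u v, e.1 = s(u, v) ∧ T.G.Adj u v ∧
      T.G.SameSide e u z := by
    rintro ⟨e, he⟩ z
    induction e with
    | _ u v =>
      obtain ⟨p⟩ := T.isTree.connected.preconnected z u
      rcases p.sameSide_or v with h | h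
      · exact ⟨u, v, rfl, he, h⟩
      · exact ⟨v, u, Sym2.eq_swap, Adj.symm he, h⟩
  obtain ⟨u, v, huv, hadj, hu⟩ := key e (Quot.out f.1).1
  obtain ⟨v', u', huv', hadj', hv'⟩ := key f u
  have hout : T.G.SameSide e (Quot.out f.1).1 u' := by
    have hu'mem : u' ∈ s((Quot.out f.1).1, (Quot.out f.1).2) := by
      rw [show s((Quot.out f.1).1, (Quot.out f.1).2) = f.1 from Quot.out_eq f.1, huv']
      exact Sym2.mem_mk_right v' u'
    rcases Sym2.mem_iff.1 hu'mem with h | h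
    · rw [← h]
    · have hf' : s((Quot.out f.1).1, (Quot.out f.1).2) = f.1 := Quot.out_eq f.1
      have hfadj : T.G.Adj (Quot.out f.1).1 (Quot.out f.1).2 := by
        rw [← mem_edgeSet, hf']
        exact f.2
      rw [h]
      exact hfadj.sameSide (by rw [hf']; exact fun h => hne (Subtype.ext h.symm))
  rw [Sym2.eq_swap] at huv'
  refine hT.false_of_same hadj hadj'.symm (huv ▸ hu.trans hout) ?_ fun i j => ?_
  · intro h
    rw [huv'] at hv'
    exact T.isTree.isAcyclic.not_sameSide hadj'.symm (h.trans hv'.symm)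
  · have := h i j
    rwa [split_eq_iff, split_eq_iff, huv, huv'] at this

lemma IsPseudostar.exists_le_card {T : WTree n} {k : ℕ} (hT : T.IsPseudostar k) (hk : 0 < k)
    (e : T.G.edgeSet) :
    ∃ i, k ≤ (Finset.univ.filter fun j => T.split e j = T.split e i).card := by
  have key : ∀ a, k ≤ (T.sideLeaves e a).ncard →
      ∃ i, k ≤ (Finset.univ.filter fun j => T.split e j = T.split e i).card := by
    intro a ha
    have hmem : ∀ i ∈ T.sideLeaves e a, T.G.SameSide e (T.leaf i) a := fun i hi => by
      by_contra h
      exact hi (T.mem_pathEdges_iff_s1.2 h)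
    obtain ⟨i, hi⟩ := Set.nonempty_of_ncard_ne_zero (hk.trans_le ha).ne'
    refine ⟨i, ha.trans ?_⟩
    rw [← Set.ncard_coe_finset]
    refine Set.ncard_le_ncard fun j hj => ?_
    simpa [split_eq_iff] using (hmem j hj).trans (hmem i hi).symm
  obtain ⟨e, he⟩ := e
  induction e with
  | _ a b => exact (hT a b he).elim (key a) (key b)

end WTree

/-- if `3 ≤ k ≤ n-1` and the family `{D_I}` is p-l-treelike, then the unique
internal-nonzero-weighted essential pseudostar of kind `(n,k)` with leaf set `[n]`
realizing the family is positive-weighted. -/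
theorem statement1 (n k : ℕ) (h3 : 3 ≤ k) (hk : k ≤ n - 1)
    (D₀ : Finset (Fin n) → ℝ)
    (hD : ∃ T : WTree n, T.PositiveWeighted ∧ T.Realizes k D₀)
    (P : WTree n)
    (hP : P.InternalNonzero ∧ P.Essential ∧ P.IsPseudostar k ∧ P.Realizes k D₀) :
    P.PositiveWeighted := by
  obtain ⟨T, hTpos, hTD⟩ := hD
  obtain ⟨hPint, hPess, hPstar, hPD⟩ := hP
  intro e he
  refine SplitSystem.weight_pos (s := P.split) (w := fun e => P.w e) (t := T.split)
    (v := fun e => T.w e) h3 (by rw [Fintype.card_fin]; omega) (fun I hI => ?_)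
    P.compatible_split T.compatible_split (fun f => hTpos f f.2) T.exists_split_isolating
    (fun _ _ => hPess.split_injective) P.exists_split_ne
    (fun f => hPstar.exists_le_card (by omega) f)
    (fun f hf => hPint f f.2 (hPess.not_isTwigEdge hf)) ⟨e, he⟩
  rw [← WTree.D_eq_diversity, ← WTree.D_eq_diversity, hPD I hI, hTD I hI]
end
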